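/- arXiv:1105.4009 — 5 statements merged into one kernel-verified Lean document; each statement's English description precedes it below -/
import Mathlib

section
/- Let X be a topological space, A an open subset of X whose closure Ā is path connected, a ∈ A, and p : X → X/A the quotient map with * = p(A). If α : [0,1] → X/A is a loop based at * such that the preimage α⁻¹((X/A) ∖ {*}) is connected, then the homotopy class [α] lies in the image of the induced homomorphism p₊ : π₁(X,a) → π₁(X/A,*). -/
/-- The relation on `X` collapsing the subset `A` to a point: the quotient `Quot (collapseRel A)`
is the quotient space `X/A` obtained by identifying `A` to a single point. -/
def collapseRel {X : Type*} (A : Set X) : X → X → Prop := fun x y => x ∈ A ∧ y ∈ A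

theorem mk_collapseRel_eq_iff {X : Type*} {A : Set X} {x y : X} :
    Quot.mk (collapseRel A) x = Quot.mk (collapseRel A) y ↔ x = y ∨ (x ∈ A ∧ y ∈ A) := by
  constructor
  · intro h
    replace h := Quot.eqvGen_exact h
    induction h with
    | rel x y h => exact .inr h
    | refl x => exact .inl rfl
    | symm x y h ih => grind
    | trans x y z h h' ih ih' => grind
  · rintro (rfl | h)
    · rfl
    · exact Quot.sound h

theorem mk_collapseRel_eq_base_iff {X : Type*} {A : Set X} {a : X} (ha : a ∈ A) {x : X} :
    Quot.mk (collapseRel A) x = Quot.mk (collapseRel A) a ↔ x ∈ A := by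
  grind [mk_collapseRel_eq_iff]

theorem isOpen_singleton_collapse {X : Type*} [TopologicalSpace X] {A : Set X} (hA : IsOpen A)
    {a : X} (ha : a ∈ A) : IsOpen {Quot.mk (collapseRel A) a} := by
  rw [← isQuotientMap_quot_mk.isOpen_preimage]
  convert hA
  ext x
  exact mk_collapseRel_eq_base_iff ha

/-- A closed set containing the collapsed set has closed image in the quotient. -/
theorem isClosed_image_mk_of_subset {X : Type*} [TopologicalSpace X] {A K : Set X}
    (hK : IsClosed K) (hAK : A ⊆ K) : IsClosed (Quot.mk (collapseRel A) '' K) := by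
  rw [← isQuotientMap_quot_mk.isClosed_preimage]
  convert hK
  ext x
  simp only [Set.mem_preimage, Set.mem_image, mk_collapseRel_eq_iff]
  grind

/-- A closed set disjoint from the collapsed set has closed image in the quotient. -/
theorem isClosed_image_mk_of_disjoint {X : Type*} [TopologicalSpace X] {A K : Set X}
    (hK : IsClosed K) (hAK : Disjoint K A) : IsClosed (Quot.mk (collapseRel A) '' K) := by
  rw [← isQuotientMap_quot_mk.isClosed_preimage]
  convert hK
  ext x
  rw [Set.disjoint_left] at hAK
  simp only [Set.mem_preimage, Set.mem_image, mk_collapseRel_eq_iff]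
  grind

theorem mem_closure_of_mk_mem_closure {X : Type*} [TopologicalSpace X] {A : Set X} {a : X}
    (ha : a ∈ A) {x : X}
    (hx : Quot.mk (collapseRel A) x ∈ closure {Quot.mk (collapseRel A) a}) : x ∈ closure A := by
  obtain ⟨z, hz, hzx⟩ := closure_minimal
    (Set.singleton_subset_iff.2 (Set.mem_image_of_mem _ (subset_closure ha)))
    (isClosed_image_mk_of_subset isClosed_closure subset_closure) hx
  rcases mk_collapseRel_eq_iff.1 hzx with rfl | h
  · exact hz
  · exact subset_closure h.2

theorem mk_mem_closure_of_mem_closure {X : Type*} [TopologicalSpace X] {A : Set X} {a : X}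
    (ha : a ∈ A) {x : X} (hx : x ∈ closure A) :
    Quot.mk (collapseRel A) x ∈ closure {Quot.mk (collapseRel A) a} := by
  refine map_mem_closure continuous_quot_mk hx fun y hy => ?_
  exact (mk_collapseRel_eq_base_iff ha).2 hy

/-- Two paths with the same endpoints inside the closure of a point are homotopic. -/
theorem Path.homotopic_of_mem_closure_singleton {Y : Type*} [TopologicalSpace Y] {x y z : Y}
    (q₀ q₁ : Path x y) (h₀ : ∀ u, q₀ u ∈ closure {z}) (h₁ : ∀ u, q₁ u ∈ closure {z}) :
    q₀.Homotopic q₁ := by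
  classical
  let F : unitInterval × unitInterval → Y := fun r =>
    if r.1 = 0 then q₀ r.2 else if r.1 = 1 ∨ r.2 = 0 ∨ r.2 = 1 then q₁ r.2 else z
  have hF : Continuous F := by
    rw [continuous_iff_isClosed]
    intro K hK
    by_cases hz : z ∈ K
    · have hsub : closure {z} ⊆ K := closure_minimal (Set.singleton_subset_iff.2 hz) hK
      convert isClosed_univ
      ext r
      simp only [Set.mem_preimage, Set.mem_univ, iff_true, F]
      split_ifs
      exacts [hsub (h₀ _), hsub (h₁ _), hz]
    · have hpre : F ⁻¹' K = ({0} ×ˢ (q₀ ⁻¹' K)) ∪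
          (({1} ×ˢ (q₁ ⁻¹' K)) ∪ (Set.univ ×ˢ ({0, 1} ∩ q₁ ⁻¹' K))) := by
        ext ⟨τ, u⟩
        have e₀ : q₀ 0 = q₁ 0 := by simp
        have e₁ : q₀ 1 = q₁ 1 := by simp
        have : (0 : unitInterval) ≠ 1 := zero_ne_one
        simp only [F, Set.mem_preimage, Set.mem_union, Set.mem_prod, Set.mem_singleton_iff,
          Set.mem_univ, Set.mem_inter_iff, Set.mem_insert_iff, true_and]
        grind
      rw [hpre]
      have k₀ := hK.preimage q₀.continuous
      have k₁ := hK.preimage q₁.continuous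
      exact (isClosed_singleton.prod k₀).union ((isClosed_singleton.prod k₁).union
        (isClosed_univ.prod (((Set.toFinite _).isClosed).inter k₁)))
  exact ⟨{
    toFun := F
    continuous_toFun := hF
    map_zero_left := fun u => by simp [F]
    map_one_left := fun u => by simp [F]
    prop' := by
      rintro τ u (rfl | rfl) <;> simp [F] }⟩

/-- Concatenating paths homotopic to three consecutive subpaths recovers the path. -/
theorem Path.trans_trans_homotopic_of_subpath {Y : Type*} [TopologicalSpace Y] {x y u v : Y}
    (α : Path x y) (s t : unitInterval) (hu : u = α s) (hv : v = α t)
    {q₁ : Path x u} {q₂ : Path u v} {q₃ : Path v y}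
    (h₁ : q₁.Homotopic ((α.subpath 0 s).cast α.source.symm hu))
    (h₂ : q₂.Homotopic ((α.subpath s t).cast hu hv))
    (h₃ : q₃.Homotopic ((α.subpath t 1).cast hv α.target.symm)) :
    ((q₁.trans q₂).trans q₃).Homotopic α := by
  subst hu hv
  refine ((h₁.hcomp h₂).hcomp h₃).trans ?_
  have h : (((α.subpath 0 s).trans (α.subpath s t)).trans (α.subpath t 1)).Homotopic
      (α.cast α.source α.target) := by
    rw [← Path.subpath_zero_one]
    exact (Path.Homotopic.hcomp ⟨Path.Homotopy.subpathTransSubpath α 0 s t⟩ (.refl _)).trans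
      ⟨Path.Homotopy.subpathTransSubpath α 0 t 1⟩
  exact h.pathCast α.source.symm α.target.symm

/-- A path avoiding the collapsed point of the quotient lifts. -/
theorem Path.exists_lift_of_ne_collapse {X : Type*} [TopologicalSpace X] {A : Set X}
    (hA : IsOpen A) {a : X} (ha : a ∈ A) {u v : Quot (collapseRel A)} (q : Path u v)
    (hq : ∀ τ, q τ ≠ Quot.mk (collapseRel A) a) :
    ∃ (x y : X) (γ : Path x y), ∀ τ, Quot.mk (collapseRel A) (γ τ) = q τ := by
  choose g hg using fun τ => Quot.exists_rep (q τ)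
  have hgA : ∀ τ, g τ ∉ A := fun τ h =>
    hq τ ((hg τ).symm.trans ((mk_collapseRel_eq_base_iff ha).2 h))
  refine ⟨g 0, g 1, ⟨⟨g, ?_⟩, rfl, rfl⟩, hg⟩
  rw [continuous_iff_isClosed]
  intro K hK
  convert (isClosed_image_mk_of_disjoint (hK.inter hA.isClosed_compl)
    (Set.disjoint_left.2 fun x hx => hx.2)).preimage q.continuous
  ext τ
  simp only [Set.mem_preimage, Set.mem_image, ← hg τ, mk_collapseRel_eq_iff]
  grind

/-- Let `A` be an open subset of `X` with path connected closure, `a ∈ A`, and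
`p : X → X/A` the quotient map with `* = p(A)`.  If `α` is a loop in `X/A` based at `*`
such that `α⁻¹((X/A) ∖ {*})` is connected, then `[α]` lies in the image of
`p₊ : π₁(X,a) → π₁(X/A,*)`. -/
theorem homotopy_class_mem_image_of_connected_preimage
    {X : Type*} [TopologicalSpace X] (A : Set X) (hA : IsOpen A)
    (hclA : IsPathConnected (closure A)) (a : X) (ha : a ∈ A)
    (α : Path (Quot.mk (collapseRel A) a) (Quot.mk (collapseRel A) a))
    (hconn : IsConnected ((α : unitInterval → Quot (collapseRel A)) ⁻¹'
      {Quot.mk (collapseRel A) a}ᶜ)) :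
    ∃ β : Path a a,
      (β.map (continuous_quot_mk : Continuous (Quot.mk (collapseRel A)))).Homotopic α := by
  have hopen := isOpen_singleton_collapse hA ha
  have hS := eq_Icc_of_connected_compact hconn
    (hopen.isClosed_compl.preimage α.continuous).isCompact
  set S := (α : unitInterval → Quot (collapseRel A)) ⁻¹' {Quot.mk (collapseRel A) a}ᶜ
  generalize sInf S = s at hS
  generalize sSup S = t at hS
  have hmem (r : unitInterval) : α r = Quot.mk (collapseRel A) a ↔ r ∉ Set.Icc s t := by
    simp [← hS, S]
  have hst : s ≤ t := Set.nonempty_Icc.1 (hS ▸ hconn.nonempty)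
  have hs0 : (0 : unitInterval) < s := by
    have := (hmem 0).1 α.source
    by_contra h
    exact this ⟨not_lt.1 h, unitInterval.nonneg'⟩
  have ht1 : t < (1 : unitInterval) := by
    have := (hmem 1).1 α.target
    by_contra h
    exact this ⟨unitInterval.le_one', not_lt.1 h⟩
  have hleft : ∀ r ≤ s, α r ∈ closure {Quot.mk (collapseRel A) a} := by
    intro r hr
    have hr' : r ∈ closure (Set.Iio s) := by
      rwa [closure_Iio' (⟨0, hs0⟩ : (Set.Iio s).Nonempty)]
    exact map_mem_closure α.continuous hr' fun w hw => (hmem w).2 fun h => hw.not_ge h.1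
  have hright : ∀ r, t ≤ r → α r ∈ closure {Quot.mk (collapseRel A) a} := by
    intro r hr
    have hr' : r ∈ closure (Set.Ioi t) := by
      rwa [closure_Ioi' (⟨1, ht1⟩ : (Set.Ioi t).Nonempty)]
    exact map_mem_closure α.continuous hr' fun w hw => (hmem w).2 fun h => hw.not_ge h.2
  have hsub {b c : unitInterval} (hbc : b ≤ c) (τ : unitInterval) :
      ∃ r ∈ Set.Icc b c, α.subpath b c τ = α r := by
    have := Set.mem_range_self (f := α.subpath b c) τ
    rw [Path.range_subpath_of_le α b c hbc] at this
    exact this.imp fun r hr => ⟨hr.1, hr.2.symm⟩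
  obtain ⟨x, y, γ, hγ⟩ := (α.subpath s t).exists_lift_of_ne_collapse hA ha fun τ h => by
    obtain ⟨r, hr, e⟩ := hsub hst τ
    exact (hmem r).1 (e ▸ h) hr
  have hx : Quot.mk (collapseRel A) x = α s := by simpa using hγ 0
  have hy : Quot.mk (collapseRel A) y = α t := by simpa using hγ 1
  obtain ⟨η, hη⟩ := hclA.joinedIn a (subset_closure ha) x
    (mem_closure_of_mk_mem_closure ha (hx ▸ hleft s le_rfl))
  obtain ⟨θ, hθ⟩ := hclA.joinedIn y
    (mem_closure_of_mk_mem_closure ha (hy ▸ hright t le_rfl)) a (subset_closure ha)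
  refine ⟨(η.trans γ).trans θ, ?_⟩
  rw [Path.map_trans, Path.map_trans]
  refine α.trans_trans_homotopic_of_subpath s t hx hy ?_ ?_ ?_
  · refine Path.homotopic_of_mem_closure_singleton _ _
      (fun τ => mk_mem_closure_of_mem_closure ha (hη τ)) fun τ => ?_
    obtain ⟨r, hr, e⟩ := hsub hs0.le τ
    simpa [e] using hleft r hr.2
  · have : γ.map continuous_quot_mk = (α.subpath s t).cast hx hy := Path.ext (funext hγ)
    rw [this]
  · refine Path.homotopic_of_mem_closure_singleton _ _
      (fun τ => mk_mem_closure_of_mem_closure ha (hθ τ)) fun τ => ?_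
    obtain ⟨r, hr, e⟩ := hsub ht1.le τ
    simpa [e] using hright r hr.1
end

section
/- Let (X,x) be a pointed topological space in which {x} is closed. Then every geometrically simple loop in X based at x is homotopic relative to endpoints to a semi-simple loop based at x. -/
/-- A loop `α` at `x` is *semi-simple* if `W_α = {(0,1)}`, i.e. `α⁻¹(X ∖ {x}) = (0,1)`. -/
def IsSemiSimpleLoop {X : Type*} [TopologicalSpace X] {x : X} (α : Path x x) : Prop :=
  (α : unitInterval → X) ⁻¹' {x}ᶜ = Set.Ioo (0 : unitInterval) 1

/-- A loop `α` at `x` is *geometrically simple* if `W_α` has exactly one element, i.e.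
`α⁻¹(X ∖ {x})` is a single nonempty open interval. -/
def IsGeometricallySimpleLoop {X : Type*} [TopologicalSpace X] {x : X} (α : Path x x) : Prop :=
  ∃ r s : unitInterval, r < s ∧ (α : unitInterval → X) ⁻¹' {x}ᶜ = Set.Ioo r s

/-- A loop `α` at `x` that equals `x` outside `(r, s)` is homotopic to its restriction to `[r, s]`,
linearly reparametrized by `[0, 1]`. -/
theorem Path.exists_homotopic_of_eq_outside_Ioo {X : Type*} [TopologicalSpace X] {x : X}
    (α : Path x x) {r s : unitInterval} (hrs : r < s) (hα : ∀ t, t ∉ Set.Ioo r s → α t = x) :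
    ∃ β : Path x x, (∀ t : unitInterval, β t = α.extend (r + t * (s - r))) ∧ α.Homotopic β := by
  have hlt : (r : ℝ) < s := hrs
  have hr : α.extend (r : ℝ) = x := by
    rw [α.extend_apply r.2]
    exact hα r (by simp)
  have hs : α.extend (s : ℝ) = x := by
    rw [α.extend_apply s.2]
    exact hα s (by simp)
  have clamp_zero : max (r : ℝ) (min 0 s) = r := by
    rw [min_eq_left s.2.1, max_eq_left r.2.1]
  have clamp_one : max (r : ℝ) (min 1 s) = s := by
    rw [min_eq_right s.2.2, max_eq_right hlt.le]
  have clamp (t : unitInterval) : α.extend (max (r : ℝ) (min t s)) = α t := by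
    by_cases ht : t ∈ Set.Ioo r s
    · have h₁ : (r : ℝ) < t := ht.1
      have h₂ : (t : ℝ) < s := ht.2
      rw [min_eq_left h₂.le, max_eq_right h₁.le, α.extend_apply t.2]
    · rw [hα t ht]
      rcases le_or_gt t r with h | h
      · have h' : (t : ℝ) ≤ r := h
        rw [max_eq_left ((min_le_left _ _).trans h'), hr]
      · have h' : (s : ℝ) ≤ t := not_lt.mp fun h'' => ht ⟨h, h''⟩
        rw [min_eq_right h', max_eq_right hlt.le, hs]
  let β : Path x x :=
    { toFun := fun t => α.extend (r + t * (s - r))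
      continuous_toFun := α.continuous_extend.comp (by fun_prop)
      source' := by simp [-Path.extend_apply, hr]
      target' := by simp [-Path.extend_apply, hs] }
  refine ⟨β, fun _ => rfl, ⟨?_⟩⟩
  exact
    { toFun := fun p => α.extend
        ((1 - p.1) * max (r : ℝ) (min p.2 s) + p.1 * (r + p.2 * (s - r)))
      continuous_toFun := α.continuous_extend.comp (by fun_prop)
      map_zero_left := fun t => by simpa [-Path.extend_apply] using clamp t
      map_one_left := fun t => by
        change _ = α.extend (r + t * (s - r))
        simp [-Path.extend_apply]
      prop' := by
        rintro u t (rfl | rfl)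
        · change α.extend ((1 - (u : ℝ)) * max (r : ℝ) (min 0 s) + u * (r + 0 * (s - r))) = α 0
          rw [clamp_zero, α.source]
          exact (congrArg α.extend (by ring)).trans hr
        · change α.extend ((1 - (u : ℝ)) * max (r : ℝ) (min 1 s) + u * (r + 1 * (s - r))) = α 1
          rw [clamp_one, α.target]
          exact (congrArg α.extend (by ring)).trans hs }

/-- In a pointed space `(X,x)` with `{x}` closed, every geometrically simple loop based at `x`
is homotopic (relative to endpoints) to a semi-simple loop based at `x`. -/
theorem geometricallySimple_homotopic_semiSimple
    {X : Type*} [TopologicalSpace X] (x : X) (hx : IsClosed ({x} : Set X))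
    (α : Path x x) (hα : IsGeometricallySimpleLoop α) :
    ∃ β : Path x x, IsSemiSimpleLoop β ∧ α.Homotopic β := by
  obtain ⟨r, s, hrs, h⟩ := hα
  have hmem (t : unitInterval) : α t ≠ x ↔ t ∈ Set.Ioo r s := by
    rw [← h]; rfl
  obtain ⟨β, hβ, hαβ⟩ := α.exists_homotopic_of_eq_outside_Ioo hrs
    fun t ht => not_not.mp fun hne => ht ((hmem t).mp hne)
  refine ⟨β, ?_, hαβ⟩
  have hlt : (0 : ℝ) < s - r := sub_pos.mpr hrs
  ext t
  have ht : (r + t * (s - r) : ℝ) ∈ Set.Icc (0 : ℝ) 1 :=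
    ⟨by nlinarith [r.2.1, t.2.1], by nlinarith [s.2.2, t.2.2]⟩
  change β t ≠ x ↔ _
  rw [hβ, α.extend_apply ht, hmem]
  change ((r : ℝ) < r + t * (s - r) ∧ (r + t * (s - r) : ℝ) < s) ↔ ((0 : ℝ) < t ∧ (t : ℝ) < 1)
  constructor
  · rintro ⟨h₁, h₂⟩
    exact ⟨by by_contra!; nlinarith, by by_contra!; nlinarith⟩
  · rintro ⟨h₁, h₂⟩
    exact ⟨by nlinarith, by nlinarith⟩
end

section
/- Let A be a closed subset of a topological space X, let p : X → X/A be the quotient map with * = p(A), and let q : X ∖ A → (X/A) ∖ {*} be the restriction of p, which is a homeomorphism. Let α be a semi-simple loop in X/A based at * and set α̃ = q⁻¹ ∘ α|₍₀,₁₎ : (0,1) → X ∖ A. If neither lim_{t→0} α̃(t) nor lim_{t→1} α̃(t) exists, then for each t₀ ∈ (0,1) there exist b₀, b₁ ∈ A such that b₀ is a limit point of α̃((0,t₀)) and b₁ is a limit point of α̃((t₀,1)). -/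
open Filter Topology

/-- If a continuous map `f` into `X/A` sends a point `e` of the closure of `S` to the collapsed point,
and `g` lifts `f` on `S`, then the closure of `g '' S` meets `A`. -/
theorem exists_mem_closure_image_of_lift {X T : Type*} [TopologicalSpace X] [TopologicalSpace T]
    {A : Set X} {a : X} (ha : a ∈ A) {f : T → Quot (collapseRel A)} {e : T}
    (hf : ContinuousAt f e) (he : f e = Quot.mk (collapseRel A) a) {S : Set T} (heS : e ∈ closure S)
    {g : T → X} (hg : ∀ t ∈ S, Quot.mk (collapseRel A) (g t) = f t) :
    ∃ b ∈ A, b ∈ closure (g '' S) := by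
  by_contra! hb
  let V : Set (Quot (collapseRel A)) := fun y =>
    Quot.lift (fun x => x ∉ closure (g '' S))
      (fun x y h => propext (iff_of_true (hb x h.1) (hb y h.2))) y
  have hV : IsOpen V := isClosed_closure.isOpen_compl
  have heV : V ∈ 𝓝 (f e) := hV.mem_nhds (he ▸ hb a ha)
  obtain ⟨t, htV, htS⟩ := mem_closure_iff_nhds.1 heS _ (hf.preimage_mem_nhds heV)
  have htV' : Quot.mk (collapseRel A) (g t) ∈ V := (hg t htS).symm ▸ htV
  exact htV' (subset_closure (Set.mem_image_of_mem g htS))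

/-- Let `A` be a closed subset of `X`, `α` a semi-simple loop in `X/A` based at `*`, and
`α̃ = q⁻¹ ∘ α|₍₀,₁₎ : (0,1) → X ∖ A` the lift of `α` through the restriction homeomorphism `q`.
If neither `lim_{t→0} α̃(t)` nor `lim_{t→1} α̃(t)` exists, then for each `t₀ ∈ (0,1)` there are
`b₀, b₁ ∈ A` such that `b₀` is a limit point of `α̃((0,t₀))` and `b₁` is a limit point of
`α̃((t₀,1))`. -/
theorem limit_points_of_semiSimple_loop
    {X : Type*} [TopologicalSpace X] (A : Set X) (hA : IsClosed A)
    (a : X) (ha : a ∈ A)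
    (α : Path (Quot.mk (collapseRel A) a) (Quot.mk (collapseRel A) a))
    (hsemi : (α : unitInterval → Quot (collapseRel A)) ⁻¹' {Quot.mk (collapseRel A) a}ᶜ =
      Set.Ioo (0 : unitInterval) 1)
    (αt : unitInterval → X)
    (hαt : ∀ t ∈ Set.Ioo (0 : unitInterval) 1, αt t ∉ A ∧ Quot.mk (collapseRel A) (αt t) = α t)
    (h0 : ¬ ∃ b : X, Tendsto αt (𝓝[Set.Ioo (0 : unitInterval) 1] 0) (𝓝 b))
    (h1 : ¬ ∃ b : X, Tendsto αt (𝓝[Set.Ioo (0 : unitInterval) 1] 1) (𝓝 b)) :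
    ∀ t₀ ∈ Set.Ioo (0 : unitInterval) 1,
      (∃ b₀ ∈ A, b₀ ∈ closure (αt '' Set.Ioo 0 t₀)) ∧
      (∃ b₁ ∈ A, b₁ ∈ closure (αt '' Set.Ioo t₀ 1)) := by
  intro t₀ ht₀
  refine ⟨exists_mem_closure_image_of_lift ha α.continuous.continuousAt α.source ?_
      fun t ht => (hαt t ⟨ht.1, ht.2.trans ht₀.2⟩).2,
    exists_mem_closure_image_of_lift ha α.continuous.continuousAt α.target ?_
      fun t ht => (hαt t ⟨ht₀.1.trans ht.1, ht.2⟩).2⟩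
  · rw [closure_Ioo ht₀.1.ne]
    exact Set.left_mem_Icc.2 ht₀.1.le
  · rw [closure_Ioo ht₀.2.ne]
    exact Set.right_mem_Icc.2 ht₀.2.le
end

section
/- Let (X,A₁,...,Aₙ) satisfy condition (*). If X is simply connected, then π₁^top(X/(A₁,...,Aₙ),*) is an indiscrete topological group; that is, its only open subsets are the empty set and the whole group. -/
/-- The relation on `X` collapsing each member of the family `A` of subsets to a point: the
quotient `Quot (collapseRelFam A)` is the quotient space `X/(A₁,…,Aₙ)`. -/
def collapseRelFam {X : Type*} {n : ℕ} (A : Fin n → Set X) : X → X → Prop :=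
  fun x y => ∃ i, x ∈ A i ∧ y ∈ A i

/-- Condition (*) on the `(n+1)`-tuple `(X, A₁, …, Aₙ)`: either
(i) `X` is path connected and each `Aᵢ` is open with path connected closure, or
(ii) `X` is first countable, connected and locally path connected, and each `Aᵢ` is open or
closed, with pairwise disjoint path connected closures. -/
def StarCondition {X : Type*} [TopologicalSpace X] {n : ℕ} (A : Fin n → Set X) : Prop :=
  (PathConnectedSpace X ∧ ∀ i, IsOpen (A i) ∧ IsPathConnected (closure (A i))) ∨
  (FirstCountableTopology X ∧ ConnectedSpace X ∧ LocPathConnectedSpace X ∧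
    (∀ i, IsOpen (A i) ∨ IsClosed (A i)) ∧ (∀ i, IsPathConnected (closure (A i))) ∧
    ∀ i j, i ≠ j → Disjoint (closure (A i)) (closure (A j)))

/-- The topological fundamental group `π₁ᵗᵒᵖ(X,x)`: homotopy classes of loops at `x` with the
quotient topology induced from the loop space (with the compact-open topology). -/
instance pathHomotopicQuotientTopology {X : Type*} [TopologicalSpace X] (x y : X) :
    TopologicalSpace (Path.Homotopic.Quotient x y) :=
  inferInstanceAs (TopologicalSpace (Quotient (Path.Homotopic.setoid x y)))

section TopologicalFundamentalGroup

open Set Filter Topology unitInterval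

universe u

variable {X Y Z : Type*} [TopologicalSpace X]

theorem JoinedIn.exists_continuous_real {S : Set X} {x y : X} (h : JoinedIn S x y) {a b : ℝ}
    (hab : a < b) : ∃ γ : ℝ → X, Continuous γ ∧ γ a = x ∧ γ b = y ∧ ∀ t, γ t ∈ S := by
  refine ⟨fun t => h.somePath.extend ((t - a) / (b - a)), ?_, by simp, ?_, fun t => ?_⟩
  · exact h.somePath.continuous_extend.comp (by fun_prop)
  · simp [div_self (sub_pos.2 hab).ne']
  · exact h.somePath_mem _

/-- A continuous map `[a, b] → X` from `x` to `y` whose image under `p`, once the values on some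
open set which it maps to `closure A` are replaced by the collapsed point, has graph in `G`. -/
def ApproxLift (p : X → Y) (A : Set X) (G : Set (ℝ × Y)) (a b : ℝ) (x y : X) : Prop :=
  ∃ γ : ℝ → X, ContinuousOn γ (Icc a b) ∧ γ a = x ∧ γ b = y ∧ ∀ t ∈ Icc a b, (t, p (γ t)) ∈ G ∨
    (t ∈ Ioo a b ∧ (∀ᶠ u in 𝓝 t, γ u ∈ closure A) ∧ ∀ z ∈ A, (t, p z) ∈ G)

namespace ApproxLift

variable {p : X → Y} {A : Set X} {G : Set (ℝ × Y)}

theorem refl {a : ℝ} {x : X} (h : (a, p x) ∈ G) : ApproxLift p A G a a x x := by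
  refine ⟨fun _ => x, continuousOn_const, rfl, rfl, fun t ht => .inl ?_⟩
  rw [Icc_self, mem_singleton_iff] at ht
  rwa [ht]

theorem trans {a b c : ℝ} {x y z : X} (hab : a ≤ b) (hbc : b ≤ c)
    (h₁ : ApproxLift p A G a b x y) (h₂ : ApproxLift p A G b c y z) :
    ApproxLift p A G a c x z := by
  obtain ⟨γ, hγ, ha, hb, hG⟩ := h₁
  obtain ⟨δ, hδ, hb', hc, hG'⟩ := h₂
  have hδ_eq : ∀ t, b ≤ t → (if t ≤ b then γ t else δ t) = δ t := by
    intro t ht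
    rcases ht.eq_or_lt with rfl | ht
    · simp [hb, hb']
    · simp [ht.not_ge]
  have hγ_eq : ∀ t, t ≤ b → (if t ≤ b then γ t else δ t) = γ t := fun t ht => if_pos ht
  refine ⟨fun t => if t ≤ b then γ t else δ t, ?_, by simp [hab, ha], (hδ_eq c hbc).trans hc, ?_⟩
  · rw [← Icc_union_Icc_eq_Icc hab hbc]
    refine ContinuousOn.union_of_isClosed ?_ ?_ isClosed_Icc isClosed_Icc
    · exact hγ.congr fun t ht => hγ_eq t ht.2
    · exact hδ.congr fun t ht => hδ_eq t ht.1
  · rintro t ⟨hat, htc⟩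
    beta_reduce
    rcases le_total t b with htb | hbt
    · rw [hγ_eq t htb]
      refine (hG t ⟨hat, htb⟩).imp_right fun ⟨ht, hcl, hz⟩ => ⟨⟨ht.1, ht.2.trans_le hbc⟩, ?_, hz⟩
      filter_upwards [hcl, Iio_mem_nhds ht.2] with u hu hub
      rwa [hγ_eq u (le_of_lt hub)]
    · rw [hδ_eq t hbt]
      refine (hG' t ⟨hbt, htc⟩).imp_right fun ⟨ht, hcl, hz⟩ => ⟨⟨hab.trans_lt ht.1, ht.2⟩, ?_, hz⟩
      filter_upwards [hcl, Ioi_mem_nhds ht.1] with u hu hub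
      rwa [hδ_eq u (le_of_lt hub)]

theorem of_joinedIn {S : Set X} {x y : X} (h : JoinedIn S x y) {a b : ℝ} (hab : a < b)
    (hG : ∀ t ∈ Icc a b, ∀ z ∈ S, (t, p z) ∈ G) : ApproxLift p A G a b x y := by
  obtain ⟨γ, hγ, ha, hb, hS⟩ := h.exists_continuous_real hab
  exact ⟨γ, hγ.continuousOn, ha, hb, fun t ht => .inl (hG t ht _ (hS t))⟩

theorem of_mem_closure (hA : IsPathConnected (closure A)) {x y : X} (hx : x ∈ closure A)
    (hy : y ∈ closure A) {a b : ℝ} (hab : a < b) (ha : (a, p x) ∈ G) (hb : (b, p y) ∈ G)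
    (hG : ∀ t ∈ Icc a b, ∀ z ∈ A, (t, p z) ∈ G) : ApproxLift p A G a b x y := by
  obtain ⟨γ, hγ, rfl, rfl, hS⟩ := (hA.joinedIn x hx y hy).exists_continuous_real hab
  refine ⟨γ, hγ.continuousOn, rfl, rfl, fun t ht => ?_⟩
  rcases ht.1.eq_or_lt with rfl | h₁
  · exact .inl ha
  rcases ht.2.eq_or_lt with rfl | h₂
  · exact .inl hb
  exact .inr ⟨⟨h₁, h₂⟩, .of_forall hS, hG t ht⟩

end ApproxLift

section IsCollapse

variable [TopologicalSpace Y]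

/-- `p` is the quotient map identifying the subset `A` to a point. -/
structure IsCollapse (p : X → Y) (A : Set X) : Prop where
  isQuotientMap : IsQuotientMap p
  eq_iff : ∀ x y, p x = p y ↔ x = y ∨ (x ∈ A ∧ y ∈ A)

namespace IsCollapse

variable {p : X → Y} {A : Set X}

theorem eq_of_mem (hp : IsCollapse p A) {x y : X} (hx : x ∈ A) (hy : y ∈ A) : p x = p y :=
  (hp.eq_iff x y).2 (.inr ⟨hx, hy⟩)

theorem mem_image_iff (hp : IsCollapse p A) {x : X} : p x ∈ p '' A ↔ x ∈ A := by
  refine ⟨?_, mem_image_of_mem p⟩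
  rintro ⟨y, hy, h⟩
  rcases (hp.eq_iff y x).1 h with rfl | h
  exacts [hy, h.2]

theorem eq_of_notMem (hp : IsCollapse p A) {x y : X} (h : p x = p y) (hx : p x ∉ p '' A) :
    x = y := by
  rcases (hp.eq_iff x y).1 h with h | h
  exacts [h, absurd (mem_image_of_mem p h.1) hx]

theorem preimage_image_of_disjoint (hp : IsCollapse p A) {T : Set X} (hT : Disjoint A T) :
    p ⁻¹' (p '' T) = T := by
  refine Subset.antisymm ?_ (subset_preimage_image p T)
  rintro x ⟨y, hy, h⟩
  rcases (hp.eq_iff y x).1 h with rfl | h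
  exacts [hy, absurd hy (disjoint_left.1 hT h.1)]

theorem preimage_image_of_subset (hp : IsCollapse p A) {T : Set X} (hT : A ⊆ T) :
    p ⁻¹' (p '' T) = T := by
  refine Subset.antisymm ?_ (subset_preimage_image p T)
  rintro x ⟨y, hy, h⟩
  rcases (hp.eq_iff y x).1 h with rfl | h
  exacts [hy, hT h.2]

theorem preimage_image_of_inter_nonempty (hp : IsCollapse p A) {T : Set X}
    (hT : (A ∩ T).Nonempty) : p ⁻¹' (p '' T) = T ∪ A := by
  obtain ⟨z, hzA, hzT⟩ := hT
  refine Subset.antisymm ?_ (union_subset (subset_preimage_image p T) fun x hx =>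
    ⟨z, hzT, hp.eq_of_mem hzA hx⟩)
  rintro x ⟨y, hy, h⟩
  rcases (hp.eq_iff y x).1 h with rfl | h
  exacts [.inl hy, .inr h.2]

theorem isClosed_image (hp : IsCollapse p A) {T : Set X} (hT : IsClosed T)
    (h : p ⁻¹' (p '' T) = T) : IsClosed (p '' T) :=
  hp.isQuotientMap.isClosed_preimage.1 (h.symm ▸ hT)

theorem isOpen_image (hp : IsCollapse p A) {T : Set X} (hT : IsOpen T)
    (h : p ⁻¹' (p '' T) = T) : IsOpen (p '' T) :=
  hp.isQuotientMap.isOpen_preimage.1 (h.symm ▸ hT)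

theorem mem_closure_of_mem_closure_image (hp : IsCollapse p A) {x : X}
    (hx : p x ∈ closure (p '' A)) : x ∈ closure A := by
  have h := hp.preimage_image_of_subset (subset_closure (s := A))
  rw [← h]
  exact closure_minimal (image_mono subset_closure) (hp.isClosed_image isClosed_closure h) hx

/-- A section of the collapsing map is continuous off the collapsed point. -/
theorem continuousOn_section (hp : IsCollapse p A) (hA : IsOpen A ∨ IsClosed A) {g : Y → X}
    (hg : ∀ y, p (g y) = y) : ContinuousOn g (p '' A)ᶜ := by
  have key : ∀ T : Set X, g ⁻¹' T ∩ (p '' A)ᶜ = p '' (T \ A) ∩ (p '' A)ᶜ := by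
    intro T
    ext y
    refine and_congr_left fun hy => ⟨fun h => ⟨g y, ⟨h, fun h' => hy ⟨g y, h', hg y⟩⟩, hg y⟩, ?_⟩
    rintro ⟨x, hx, rfl⟩
    have := hp.eq_of_notMem (hg (p x)).symm hy
    simpa [mem_preimage, ← this] using hx.1
  rcases hA with hA | hA
  · refine continuousOn_iff_isClosed.2 fun T hT => ⟨p '' (T \ A), ?_, key T⟩
    exact hp.isClosed_image (hT.sdiff hA) (hp.preimage_image_of_disjoint disjoint_sdiff_right)
  · refine continuousOn_iff'.2 fun T hT => ⟨p '' (T \ A), ?_, key T⟩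
    exact hp.isOpen_image (hT.sdiff hA) (hp.preimage_image_of_disjoint disjoint_sdiff_right)

end IsCollapse

namespace ApproxLift

variable {p : X → Y} {A : Set X} {G : Set (ℝ × Y)}

theorem of_notMem (hp : IsCollapse p A) (hA : IsOpen A ∨ IsClosed A) {α : ℝ → Y}
    (hα : Continuous α) {a b : ℝ} (hab : a ≤ b) (h : ∀ t ∈ Icc a b, α t ∉ p '' A)
    (hG : ∀ t ∈ Icc a b, (t, α t) ∈ G) {x y : X} (hx : p x = α a) (hy : p y = α b) :
    ApproxLift p A G a b x y := by
  obtain ⟨g, hg⟩ := hp.isQuotientMap.surjective.hasRightInverse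
  refine ⟨fun t => g (α t), ?_, ?_, ?_, fun t ht => .inl ?_⟩
  · exact (hp.continuousOn_section hA hg).comp hα.continuousOn h
  · exact hp.eq_of_notMem ((hg _).trans hx.symm)
      (by rw [hg]; exact h a (left_mem_Icc.2 hab))
  · exact hp.eq_of_notMem ((hg _).trans hy.symm)
      (by rw [hg]; exact h b (right_mem_Icc.2 hab))
  · rw [hg]
    exact hG t ht

/-- Local existence of approximate lifts when the collapsed set is open. -/
theorem exists_of_isOpen (hp : IsCollapse p A) (hA : IsOpen A)
    (hcl : IsPathConnected (closure A)) {α : ℝ → Y} (hα : Continuous α) {a b : ℝ} (hab : a ≤ b)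
    {V : Set Y} (hαV : ∀ t ∈ Icc a b, α t ∈ V)
    (hG : ∀ t ∈ Icc a b, ∀ y ∈ V, (t, y) ∈ G) {x : X} (hx : p x = α a) :
    ∃ y, p y = α b ∧ ApproxLift p A G a b x y := by
  have hsurj := hp.isQuotientMap.surjective
  have hGα : ∀ t ∈ Icc a b, (t, α t) ∈ G := fun t ht => hG t ht _ (hαV t ht)
  rcases hab.eq_or_lt with rfl | hab'
  · exact ⟨x, hx, refl (hx ▸ hGα a (left_mem_Icc.2 le_rfl))⟩
  set O : Set ℝ := Icc a b ∩ α ⁻¹' (p '' A)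
  have hpA : IsOpen (p '' A) := hp.isOpen_image hA (hp.preimage_image_of_subset le_rfl)
  rcases O.eq_empty_or_nonempty with hemp | hne
  · obtain ⟨y, hy⟩ := hsurj (α b)
    refine ⟨y, hy, of_notMem hp (.inl hA) hα hab (fun t ht h => ?_) hGα hx hy⟩
    exact (hemp ▸ (⟨ht, h⟩ : t ∈ O) : t ∈ (∅ : Set ℝ))
  have hbb : BddBelow O := bddBelow_Icc.mono inter_subset_left
  have hba : BddAbove O := bddAbove_Icc.mono inter_subset_left
  set s := sInf O
  set t := sSup O
  have hst : s ≤ t := (csInf_le hbb hne.some_mem).trans (le_csSup hba hne.some_mem)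
  have has : a ≤ s := le_csInf hne fun u hu => hu.1.1
  have htb : t ≤ b := csSup_le hne fun u hu => hu.1.2
  have hαs : α s ∈ closure (p '' A) :=
    map_mem_closure hα (csInf_mem_closure hne hbb) fun u hu => hu.2
  have hαt : α t ∈ closure (p '' A) :=
    map_mem_closure hα (csSup_mem_closure hne hba) fun u hu => hu.2
  have hs_not : a < s → ∀ u ∈ Icc a s, α u ∉ p '' A := by
    intro has' u hu h
    have hus : u = s := hu.2.antisymm (csInf_le hbb ⟨⟨hu.1, hu.2.trans (hst.trans htb)⟩, h⟩)
    subst hus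
    obtain ⟨v, hv, hvs⟩ : ∃ v, v ∈ Ioo a s ∧ α v ∈ p '' A := by
      have h1 : ∀ᶠ v in 𝓝[<] s, v ∈ Ioo a s := Ioo_mem_nhdsLT has'
      have h2 : ∀ᶠ v in 𝓝[<] s, α v ∈ p '' A :=
        (hα.continuousAt.eventually (hpA.mem_nhds h)).filter_mono nhdsWithin_le_nhds
      exact (h1.and h2).exists
    exact hv.2.not_ge (csInf_le hbb ⟨⟨hv.1.le, hv.2.le.trans (hst.trans htb)⟩, hvs⟩)
  have ht_not : t < b → ∀ u ∈ Icc t b, α u ∉ p '' A := by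
    intro htb' u hu h
    have hus : t = u := hu.1.antisymm (le_csSup hba ⟨⟨(has.trans hst).trans hu.1, hu.2⟩, h⟩)
    subst hus
    obtain ⟨v, hv, hvs⟩ : ∃ v, v ∈ Ioo t b ∧ α v ∈ p '' A := by
      have h1 : ∀ᶠ v in 𝓝[>] t, v ∈ Ioo t b := Ioo_mem_nhdsGT htb'
      have h2 : ∀ᶠ v in 𝓝[>] t, α v ∈ p '' A :=
        (hα.continuousAt.eventually (hpA.mem_nhds h)).filter_mono nhdsWithin_le_nhds
      exact (h1.and h2).exists
    exact hv.1.not_ge (le_csSup hba ⟨⟨(has.trans hst).trans hv.1.le, hv.2.le⟩, hvs⟩)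
  have hsm : s ∈ Icc a b := ⟨has, hst.trans htb⟩
  have htm : t ∈ Icc a b := ⟨has.trans hst, htb⟩
  obtain ⟨x', hx', h₁⟩ : ∃ x', p x' = α s ∧ ApproxLift p A G a s x x' := by
    rcases has.eq_or_lt with h | h
    · rw [← h]
      exact ⟨x, hx, refl (hx ▸ hGα a (left_mem_Icc.2 hab))⟩
    · obtain ⟨x', hx'⟩ := hsurj (α s)
      exact ⟨x', hx', of_notMem hp (.inl hA) hα has (hs_not h)
        (fun u hu => hGα u ⟨hu.1, hu.2.trans hsm.2⟩) hx hx'⟩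
  obtain ⟨y', hy', h₂⟩ : ∃ y', p y' = α t ∧ ApproxLift p A G s t x' y' := by
    rcases hst.eq_or_lt with h | h
    · rw [← h]
      exact ⟨x', hx', refl (hx' ▸ hGα s hsm)⟩
    · obtain ⟨y', hy'⟩ := hsurj (α t)
      refine ⟨y', hy', of_mem_closure hcl (hp.mem_closure_of_mem_closure_image (hx' ▸ hαs))
        (hp.mem_closure_of_mem_closure_image (hy' ▸ hαt)) h (hx' ▸ hGα s hsm) (hy' ▸ hGα t htm) ?_⟩
      intro u hu z hz
      obtain ⟨v, hv, w, hw, hwv⟩ := hne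
      refine hG u ⟨has.trans hu.1, hu.2.trans htb⟩ _ ?_
      rw [hp.eq_of_mem hz hw, hwv]
      exact hαV v hv
  obtain ⟨y, hy, h₃⟩ : ∃ y, p y = α b ∧ ApproxLift p A G t b y' y := by
    rcases htb.eq_or_lt with h | h
    · rw [h] at hy' ⊢
      exact ⟨y', hy', refl (hy' ▸ hGα b (right_mem_Icc.2 hab))⟩
    · obtain ⟨y, hy⟩ := hsurj (α b)
      exact ⟨y, hy, of_notMem hp (.inl hA) hα htb (ht_not h)
        (fun u hu => hGα u ⟨htm.1.trans hu.1, hu.2⟩) hy' hy⟩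
  exact ⟨y, hy, h₁.trans has (hst.trans htb) (h₂.trans hst htb h₃)⟩

/-- Local existence of approximate lifts when the collapsed set is closed. -/
theorem exists_of_isClosed [LocallyPathConnectedSpace X] (hp : IsCollapse p A) (hA : IsClosed A)
    (hpc : IsPathConnected A) {α : ℝ → Y} (hα : Continuous α) {a b : ℝ} (hab : a ≤ b)
    {V : Set Y} (hV : IsOpen V) (hαV : ∀ t ∈ Icc a b, α t ∈ V)
    (hG : ∀ t ∈ Icc a b, ∀ y ∈ V, (t, y) ∈ G) {x : X} (hx : p x = α a) :
    ∃ y, p y = α b ∧ ApproxLift p A G a b x y := by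
  have hsurj := hp.isQuotientMap.surjective
  have hGα : ∀ t ∈ Icc a b, (t, α t) ∈ G := fun t ht => hG t ht _ (hαV t ht)
  set C : Set ℝ := Icc a b ∩ α ⁻¹' (p '' A)
  have hpA : IsClosed (p '' A) := hp.isClosed_image hA (hp.preimage_image_of_subset le_rfl)
  rcases C.eq_empty_or_nonempty with hemp | hne
  · obtain ⟨y, hy⟩ := hsurj (α b)
    refine ⟨y, hy, of_notMem hp (.inr hA) hα hab (fun t ht h => ?_) hGα hx hy⟩
    exact (hemp ▸ (⟨ht, h⟩ : t ∈ C) : t ∈ (∅ : Set ℝ))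
  have hCc : IsCompact C := isCompact_Icc.inter_right (hpA.preimage hα)
  obtain ⟨s, ⟨hsm, hsA⟩, hs_least⟩ := hCc.exists_isLeast hne
  obtain ⟨t, ⟨htm, htA⟩, ht_greatest⟩ := hCc.exists_isGreatest hne
  have hst : s ≤ t := hs_least ⟨htm, htA⟩
  -- A saturated path connected open neighbourhood of `A` mapped into `V`.
  obtain ⟨a₀, ha₀, ha₀s⟩ := hsA
  have hAV : A ⊆ p ⁻¹' V := fun z hz => by
    rw [mem_preimage, hp.eq_of_mem hz ha₀, ha₀s]
    exact hαV s hsm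
  set W := pathComponentIn (p ⁻¹' V) a₀
  have hAW : A ⊆ W := hpc.subset_pathComponentIn ha₀ hAV
  have hWo : IsOpen W := (hV.preimage hp.isQuotientMap.continuous).pathComponentIn a₀
  have hWpc : IsPathConnected W := isPathConnected_pathComponentIn (hAV ha₀)
  have hWV : W ⊆ p ⁻¹' V := pathComponentIn_subset
  have hWsat : p ⁻¹' (p '' W) = W := hp.preimage_image_of_subset hAW
  have hpW : IsOpen (p '' W) := hp.isOpen_image hWo hWsat
  have hmemW : ∀ z, p z ∈ p '' W → z ∈ W := fun z hz => hWsat ▸ hz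
  have hpAW : p '' A ⊆ p '' W := image_mono hAW
  obtain ⟨x', hx', h₁⟩ : ∃ x' ∈ A, ApproxLift p A G a s x x' := by
    rcases hsm.1.eq_or_lt with h | h
    · rw [← h] at ha₀s ⊢
      exact ⟨x, hp.mem_image_iff.1 (hx ▸ ha₀s ▸ mem_image_of_mem p ha₀),
        refl (hx ▸ hGα a (left_mem_Icc.2 hab))⟩
    · refine ⟨a₀, ha₀, ?_⟩
      obtain ⟨v, hv, hvW⟩ : ∃ v, v ∈ Ioo a s ∧ α v ∈ p '' W := by
        have h1 : ∀ᶠ v in 𝓝[<] s, v ∈ Ioo a s := Ioo_mem_nhdsLT h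
        have h2 : ∀ᶠ v in 𝓝[<] s, α v ∈ p '' W :=
          (hα.continuousAt.eventually (hpW.mem_nhds (ha₀s ▸ hpAW ⟨a₀, ha₀, rfl⟩))).filter_mono
            nhdsWithin_le_nhds
        exact (h1.and h2).exists
      obtain ⟨w, hw⟩ := hsurj (α v)
      refine trans hv.1.le hv.2.le (of_notMem hp (.inr hA) hα hv.1.le ?_ ?_ hx hw)
        (of_joinedIn (hWpc.joinedIn w (hmemW w (hw ▸ hvW)) a₀ (hAW ha₀)) hv.2 ?_)
      · exact fun u hu hu' => (hu.2.trans_lt hv.2).not_ge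
          (hs_least ⟨⟨hu.1, hu.2.trans (hv.2.le.trans hsm.2)⟩, hu'⟩)
      · exact fun u hu => hGα u ⟨hu.1, hu.2.trans (hv.2.le.trans hsm.2)⟩
      · exact fun u hu z hz => hG u ⟨hv.1.le.trans hu.1, hu.2.trans hsm.2⟩ _ (hWV hz)
  have h₂ : ApproxLift p A G s t x' x' :=
    ⟨fun _ => x', continuousOn_const, rfl, rfl, fun u hu =>
      .inl (hG u ⟨hsm.1.trans hu.1, hu.2.trans htm.2⟩ _ (hAV hx'))⟩
  have hx't : p x' = α t := by
    obtain ⟨z, hz, hzt⟩ := htA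
    rw [hp.eq_of_mem hx' hz, hzt]
  obtain ⟨y, hy, h₃⟩ : ∃ y, p y = α b ∧ ApproxLift p A G t b x' y := by
    rcases htm.2.eq_or_lt with h | h
    · rw [h] at hx't ⊢
      exact ⟨x', hx't, refl (hx't ▸ hGα b (right_mem_Icc.2 hab))⟩
    · obtain ⟨v, hv, hvW⟩ : ∃ v, v ∈ Ioo t b ∧ α v ∈ p '' W := by
        have h1 : ∀ᶠ v in 𝓝[>] t, v ∈ Ioo t b := Ioo_mem_nhdsGT h
        have h2 : ∀ᶠ v in 𝓝[>] t, α v ∈ p '' W :=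
          (hα.continuousAt.eventually (hpW.mem_nhds (hpAW htA))).filter_mono nhdsWithin_le_nhds
        exact (h1.and h2).exists
      obtain ⟨w, hw⟩ := hsurj (α v)
      obtain ⟨y, hy⟩ := hsurj (α b)
      refine ⟨y, hy, trans hv.1.le hv.2.le
        (of_joinedIn (hWpc.joinedIn x' (hAW hx') w (hmemW w (hw ▸ hvW))) hv.1 ?_)
        (of_notMem hp (.inr hA) hα hv.2.le ?_ ?_ hw hy)⟩
      · exact fun u hu z hz => hG u ⟨htm.1.trans hu.1, hu.2.trans hv.2.le⟩ _ (hWV hz)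
      · exact fun u hu hu' => (hv.1.trans_le hu.1).not_ge
          (ht_greatest ⟨⟨htm.1.trans (hv.1.le.trans hu.1), hu.2⟩, hu'⟩)
      · exact fun u hu => hGα u ⟨htm.1.trans (hv.1.le.trans hu.1), hu.2⟩
  exact ⟨y, hy, h₁.trans hsm.1 (hst.trans htm.2) (h₂.trans hst htm.2 h₃)⟩

end ApproxLift

end IsCollapse

variable [TopologicalSpace Y] [TopologicalSpace Z]

section HasDenseLoops

/-- Homotopy classes of loops which come from `X` are dense in the topological fundamental group
of `Y` at each base point in the image of `p`. -/
def HasDenseLoops (p : C(X, Y)) : Prop :=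
  ∀ (x : X) (U : Set (Path (p x) (p x))), IsOpen U → (∀ β β', β.Homotopic β' → β ∈ U → β' ∈ U) →
    U.Nonempty → ∃ γ : Path x x, γ.map p.continuous ∈ U

theorem HasDenseLoops.comp {p : C(X, Y)} {q : C(Y, Z)} (hq : HasDenseLoops q)
    (hp : HasDenseLoops p) : HasDenseLoops (q.comp p) := by
  intro x U hU hsat hne
  obtain ⟨γ, hγ⟩ := hq (p x) U hU hsat hne
  have hcont : Continuous fun β : Path (p x) (p x) => β.map q.continuous := by
    refine continuous_induced_rng.2 ?_
    exact q.continuous_postcomp.comp continuous_induced_dom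
  exact hp x _ (hU.preimage hcont) (fun β β' h => hsat _ _ (h.map q)) ⟨γ, hγ⟩

theorem ContinuousMap.exists_isOpen_graph_of_isOpen {K : Type*} [TopologicalSpace K] [T2Space K]
    {U : Set C(K, Y)} (hU : IsOpen U) {f : C(K, Y)} (hf : f ∈ U) :
    ∃ G : Set (K × Y), IsOpen G ∧ (∀ t, (t, f t) ∈ G) ∧
      ∀ g : C(K, Y), (∀ t, (t, g t) ∈ G) → g ∈ U := by
  induction hU with
  | basic s hs =>
    obtain ⟨C, hC, V, hV, rfl⟩ := hs
    refine ⟨{x | x.1 ∈ Cᶜ} ∪ {x | x.2 ∈ V}, ?_, fun t => ?_, fun g hg t ht => ?_⟩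
    · exact (IsCompact.isClosed hC).isOpen_compl.preimage continuous_fst |>.union
        (IsOpen.preimage continuous_snd hV)
    · by_cases ht : t ∈ C
      exacts [.inr (hf ht), .inl ht]
    · exact (hg t).resolve_left fun h => h ht
  | univ => exact ⟨univ, isOpen_univ, fun _ => trivial, fun _ _ => trivial⟩
  | inter s t _ _ ihs iht =>
    obtain ⟨G, hG, hfG, h⟩ := ihs hf.1
    obtain ⟨G', hG', hfG', h'⟩ := iht hf.2
    exact ⟨G ∩ G', hG.inter hG', fun t => ⟨hfG t, hfG' t⟩,
      fun g hg => ⟨h g fun t => (hg t).1, h' g fun t => (hg t).2⟩⟩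
  | sUnion S _ ih =>
    obtain ⟨s, hs, hfs⟩ := hf
    obtain ⟨G, hG, hfG, h⟩ := ih s hs hfs
    exact ⟨G, hG, hfG, fun g hg => ⟨s, hs, h g hg⟩⟩

/-- Replacing the values of a path on an open set by a point of which they are specializations
gives a homotopic path, provided that this point is open. -/
theorem Path.exists_homotopic_of_mem_closure {x y z : Y} (hz : IsOpen {z}) (β : Path x y)
    {O : Set I} (hO : IsOpen O) (h : ∀ t ∈ O, β t ∈ closure {z}) (h0 : 0 ∉ O) (h1 : 1 ∉ O) :
    ∃ β' : Path x y, β.Homotopic β' ∧ (∀ t ∈ O, β' t = z) ∧ ∀ t ∉ O, β' t = β t := by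
  classical
  let H : I × I → Y := fun q => if q.2 ∈ O ∧ 0 < q.1 then z else β q.2
  have hH : Continuous H := by
    refine continuous_def.2 fun V hV => ?_
    have hS : IsOpen {q : I × I | q.2 ∈ O ∧ 0 < q.1} :=
      (hO.preimage continuous_snd).inter (isOpen_Ioi.preimage continuous_fst)
    have hβV : IsOpen {q : I × I | β q.2 ∈ V} :=
      hV.preimage (β.continuous.comp continuous_snd)
    by_cases hzV : z ∈ V
    · have : H ⁻¹' V = {q : I × I | q.2 ∈ O ∧ 0 < q.1} ∪ {q : I × I | β q.2 ∈ V} := by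
        ext q
        by_cases hq : q.2 ∈ O ∧ 0 < q.1
        · simp [H, hq, hzV]
        · simp [H, hq]
      rw [this]
      exact hS.union hβV
    · have hβz : ∀ t ∈ O, β t ∉ V := fun t ht htV => by
        obtain ⟨w, hwV, rfl⟩ := mem_closure_iff.1 (h t ht) V hV htV
        exact hzV hwV
      have : H ⁻¹' V = {q : I × I | β q.2 ∈ V} := by
        ext q
        by_cases hq : q.2 ∈ O ∧ 0 < q.1
        · simp [H, hq, hzV, hβz q.2 hq.1]
        · simp only [H, mem_preimage, if_neg hq, mem_ofPred_eq]
      rw [this]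
      exact hβV
  let β' : Path x y :=
    { toFun := fun t => H (1, t)
      continuous_toFun := hH.comp (by fun_prop)
      source' := by simp [H, h0]
      target' := by simp [H, h1] }
  let F : β.Homotopy β' :=
    { toFun := H
      continuous_toFun := hH
      map_zero_left := fun t => by simp [H]
      map_one_left := fun t => rfl
      prop' := by
        rintro s t (rfl | rfl)
        · simp [H, h0]
        · simp [H, h1] }
  refine ⟨β', ⟨F⟩, fun t ht => ?_, fun t ht => ?_⟩
  · change H (1, t) = z
    simp [H, ht]
  · change H (1, t) = β t
    simp [H, ht]

variable {p : X → Y} {A : Set X}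

theorem ApproxLift.exists_of_local {G : Set (ℝ × Y)} (hG : IsOpen G) {α : ℝ → Y}
    (hα : Continuous α) {a b : ℝ} (hab : a ≤ b) (hαG : ∀ t ∈ Icc a b, (t, α t) ∈ G)
    (hloc : ∀ (c d : ℝ) (V : Set Y), c ≤ d → IsOpen V → (∀ t ∈ Icc c d, α t ∈ V) →
      (∀ t ∈ Icc c d, ∀ y ∈ V, (t, y) ∈ G) → ∀ x, p x = α c →
      ∃ y, p y = α d ∧ ApproxLift p A G c d x y) {x : X} (hx : p x = α a) :
    ∃ y, p y = α b ∧ ApproxLift p A G a b x y := by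
  have hbox : ∀ i : Icc a b, ∃ (N : Set ℝ) (V : Set Y), IsOpen N ∧ IsOpen V ∧ (i : ℝ) ∈ N ∧
      α i ∈ V ∧ N ×ˢ V ⊆ G := fun i => isOpen_prod_iff.1 hG _ _ (hαG i i.2)
  choose N V hN hV hiN hiV hNV using hbox
  obtain ⟨t, ht0, htm, ⟨m, hm⟩, ht⟩ := exists_monotone_Icc_subset_open_cover_Icc hab
    (c := fun i => ((↑) : Icc a b → ℝ) ⁻¹' (N i ∩ α ⁻¹' V i))
    (fun i => ((hN i).inter ((hV i).preimage hα)).preimage continuous_subtype_val)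
    fun i _ => mem_iUnion.2 ⟨i, hiN i, hiV i⟩
  suffices h : ∀ n, ∃ y, p y = α (t n) ∧ ApproxLift p A G a (t n) x y by
    simpa [hm m le_rfl] using h m
  intro n
  induction n with
  | zero =>
    rw [ht0]
    exact ⟨x, hx, .refl (hx ▸ hαG a (left_mem_Icc.2 hab))⟩
  | succ n ih =>
    obtain ⟨y, hy, hL⟩ := ih
    obtain ⟨i, hi⟩ := ht n
    have hi' : ∀ u ∈ Icc (t n : ℝ) (t (n + 1)), u ∈ N i ∧ α u ∈ V i := fun u hu =>
      hi (show (⟨u, (t n).2.1.trans hu.1, hu.2.trans (t (n + 1)).2.2⟩ : Icc a b) ∈ _ from hu)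
    have hle : (t n : ℝ) ≤ t (n + 1) := htm n.le_succ
    obtain ⟨z, hz, hLz⟩ := hloc (t n) (t (n + 1)) (V i) hle (hV i) (fun u hu => (hi' u hu).2)
      (fun u hu v hv => hNV i ⟨(hi' u hu).1, hv⟩) y hy
    exact ⟨z, hz, hL.trans (t n).2.1 hle hLz⟩

/-- Collapsing a subset to a point induces a map with dense image on topological fundamental
groups, provided that the subset is either open with path connected closure, or closed and path
connected in a locally path connected space. -/
theorem IsCollapse.hasDenseLoops {p : C(X, Y)} (hp : IsCollapse p A)
    (hA : IsOpen A ∨ (IsClosed A ∧ LocallyPathConnectedSpace X))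
    (hcl : IsPathConnected (closure A)) : HasDenseLoops p := by
  rintro x U hU hsat ⟨α₀, hα₀⟩
  obtain ⟨z₀, hz₀⟩ : A.Nonempty := closure_nonempty_iff.1 hcl.nonempty
  -- Making the loop constant on `[1/2, 1]` leaves room for correcting the end point of a lift.
  set α := α₀.trans (Path.refl (p x)) with hα_def
  have hαU : α ∈ U := hsat _ _ ⟨(Path.Homotopy.transRefl α₀).symm⟩ hα₀
  obtain ⟨U', hU', rfl⟩ := isOpen_induced_iff.1 hU
  obtain ⟨G₀, hG₀, hαG₀, hG₀U⟩ := ContinuousMap.exists_isOpen_graph_of_isOpen hU' hαU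
  set G : Set (ℝ × Y) := {q | (projIcc 0 1 zero_le_one q.1, q.2) ∈ G₀} with hG_def
  have hG : IsOpen G := hG₀.preimage (by fun_prop)
  have hαG : ∀ t, (t, α.extend t) ∈ G := fun t => hαG₀ _
  have hα1 : ∀ t, 1 / 2 ≤ t → α.extend t = p x := fun t ht => by
    rw [hα_def, Path.extend_trans_of_half_le _ _ ht]
    simp
  obtain ⟨y, hy, h₁⟩ : ∃ y, p y = α.extend (1 / 2) ∧ ApproxLift p A G 0 (1 / 2) x y := by
    refine ApproxLift.exists_of_local hG α.continuous_extend (by norm_num) (fun t _ => hαG t) ?_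
      (by simp)
    intro c d V hcd hV hαV hVG x hx
    rcases hA with hA | ⟨hA, hX⟩
    · exact ApproxLift.exists_of_isOpen hp hA hcl α.continuous_extend hcd hαV hVG hx
    · exact ApproxLift.exists_of_isClosed hp hA (hA.closure_eq ▸ hcl) α.continuous_extend hcd hV
        hαV hVG hx
  rw [hα1 _ le_rfl] at hy
  have hxG : ∀ t, 1 / 2 ≤ t → (t, p x) ∈ G := fun t ht => hα1 t ht ▸ hαG t
  have h₂ : ApproxLift p A G (1 / 2) 1 y x := by
    rcases (hp.eq_iff y x).1 hy with rfl | ⟨hyA, hxA⟩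
    · exact ⟨fun _ => y, continuousOn_const, rfl, rfl, fun t ht => .inl (hxG t ht.1)⟩
    · refine ApproxLift.of_mem_closure hcl (subset_closure hyA) (subset_closure hxA) (by norm_num)
        (hy ▸ hxG _ le_rfl) (hxG _ (by norm_num)) fun t ht z hz => ?_
      rw [hp.eq_of_mem hz hxA]
      exact hxG t ht.1
  obtain ⟨γ, hγ, h0, h1, hγG⟩ := h₁.trans (by norm_num) (by norm_num) h₂
  let γ' : Path x x := Path.ofLine hγ h0 h1
  have hγ' : ∀ t, γ' t = γ t := fun t => rfl
  refine ⟨γ', ?_⟩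
  have hend : ∀ t : I, (t, p (γ' t)) ∈ G₀ ∨ (t : ℝ) ∈ Ioo 0 1 ∧
      (∀ᶠ u in 𝓝 (t : ℝ), γ u ∈ closure A) ∧ ∀ z ∈ A, (t, p z) ∈ G₀ := fun t => by
    simpa [hG_def, hγ'] using hγG t t.2
  rcases hA with hA | ⟨hA, -⟩
  · let O : Set I := ((↑) : I → ℝ) ⁻¹' (Ioo 0 1 ∩ interior {u | γ u ∈ closure A}) ∩
      {t | (t, p z₀) ∈ G₀}
    have hO : IsOpen O :=
      ((isOpen_Ioo.inter isOpen_interior).preimage continuous_subtype_val).inter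
        (hG₀.preimage (by fun_prop))
    have hz : IsOpen {p z₀} := by
      have : p '' A = {p z₀} := by
        refine Subset.antisymm ?_ (by simpa using ⟨z₀, hz₀, rfl⟩)
        rintro _ ⟨w, hw, rfl⟩
        exact hp.eq_of_mem hw hz₀
      exact this ▸ hp.isOpen_image hA (hp.preimage_image_of_subset le_rfl)
    obtain ⟨β, hβ, hβO, hβO'⟩ := (γ'.map p.continuous).exists_homotopic_of_mem_closure hz hO
      (fun t ht => by
        have hγt : γ' t ∈ closure A :=
          interior_subset (s := {u | γ u ∈ closure A}) ht.1.2
        refine map_mem_closure (f := p) p.continuous hγt ?_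
        exact fun w hw => hp.eq_of_mem hw hz₀)
      (fun h => by simpa using h.1.1) (fun h => by simpa using h.1.1)
    refine hsat _ _ hβ.symm (hG₀U _ fun t => ?_)
    change (t, β t) ∈ G₀
    by_cases ht : t ∈ O
    · rw [hβO t ht]
      exact ht.2
    · rw [hβO' t ht]
      exact (hend t).resolve_right fun h =>
        ht ⟨⟨h.1, mem_interior_iff_mem_nhds.2 h.2.1⟩, h.2.2 z₀ hz₀⟩
  · refine hG₀U _ fun t => (hend t).elim id fun h => ?_
    exact h.2.2 _ (hA.closure_eq ▸ h.2.1.self_of_nhds)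

end HasDenseLoops

section Family

/-- A condition on a finite family of subsets, weaker than `StarCondition`, which is inherited by
the images of the remaining members when one member is collapsed. -/
def CollapseCondition {n : ℕ} (A : Fin n → Set X) : Prop :=
  (∀ i, IsPathConnected (closure (A i))) ∧ ((∀ i, IsOpen (A i)) ∨
    (LocallyPathConnectedSpace X ∧ (∀ i, IsOpen (A i) ∨ IsClosed (A i)) ∧
      ∀ i j, i ≠ j → Disjoint (closure (A i)) (closure (A j))))

theorem StarCondition.collapseCondition {n : ℕ} {A : Fin n → Set X} (h : StarCondition A) :
    CollapseCondition A := by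
  rcases h with ⟨-, h⟩ | ⟨-, -, hX, h₁, h₂, h₃⟩
  · exact ⟨fun i => (h i).2, .inl fun i => (h i).1⟩
  · exact ⟨h₂, .inr ⟨hX, h₁, h₃⟩⟩

namespace IsCollapse

variable {p : X → Y} {A B : Set X}

theorem closure_image_of_disjoint (hp : IsCollapse p A) (h : Disjoint A (closure B)) :
    closure (p '' B) = p '' closure B :=
  (closure_minimal (image_mono subset_closure)
    (hp.isClosed_image isClosed_closure (hp.preimage_image_of_disjoint h))).antisymm
    (image_closure_subset_closure_image hp.isQuotientMap.continuous)

theorem isOpen_image_of_isOpen (hp : IsCollapse p A) (hA : IsOpen A) (hB : IsOpen B) :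
    IsOpen (p '' B) := by
  rcases (A ∩ B).eq_empty_or_nonempty with h | h
  · exact hp.isOpen_image hB (hp.preimage_image_of_disjoint (disjoint_iff_inter_eq_empty.2 h))
  · refine hp.isQuotientMap.isOpen_preimage.1 ?_
    rw [hp.preimage_image_of_inter_nonempty h]
    exact hB.union hA

theorem isPathConnected_closure_image_of_isOpen (hp : IsCollapse p A) (hA : IsOpen A)
    (hcA : IsPathConnected (closure A)) (hcB : IsPathConnected (closure B)) :
    IsPathConnected (closure (p '' B)) := by
  have hc := hp.isQuotientMap.continuous
  rcases (A ∩ B).eq_empty_or_nonempty with h | h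
  · rw [hp.closure_image_of_disjoint]
    · exact hcB.image hc
    · exact (disjoint_iff_inter_eq_empty.2 h).closure_right hA
  · obtain ⟨z, hzA, hzB⟩ := h
    have hT : A ⊆ closure B ∪ closure A := fun x hx => .inr (subset_closure hx)
    have hcl : closure (p '' B) = p '' (closure B ∪ closure A) := by
      refine (closure_minimal (image_mono fun x hx => .inl (subset_closure hx))
        (hp.isClosed_image (isClosed_closure.union isClosed_closure)
          (hp.preimage_image_of_subset hT))).antisymm ?_
      rw [image_union]
      refine union_subset (image_closure_subset_closure_image hc) ?_
      refine (image_closure_subset_closure_image hc).trans (closure_mono ?_)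
      rintro _ ⟨w, hw, rfl⟩
      exact ⟨z, hzB, hp.eq_of_mem hzA hw⟩
    rw [hcl]
    exact (hcB.union hcA ⟨z, subset_closure hzB, subset_closure hzA⟩).image hc

theorem collapseCondition_image {n : ℕ} {A : Fin (n + 1) → Set X} (hp : IsCollapse p (A 0))
    (h : CollapseCondition A) : CollapseCondition fun i : Fin n => p '' A i.succ := by
  obtain ⟨hpc, h | ⟨hX, hoc, hd⟩⟩ := h
  · exact ⟨fun i => hp.isPathConnected_closure_image_of_isOpen (h 0) (hpc 0) (hpc _),
      .inl fun i => hp.isOpen_image_of_isOpen (h 0) (h _)⟩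
  · have hdis : ∀ i : Fin n, Disjoint (A 0) (closure (A i.succ)) := fun i =>
      (hd 0 i.succ (Fin.succ_ne_zero i).symm).mono_left subset_closure
    have hsat := fun i => hp.preimage_image_of_disjoint ((hdis i).mono_right subset_closure)
    refine ⟨fun i => ?_, .inr ⟨hp.isQuotientMap.locallyPathConnectedSpace, fun i => ?_, ?_⟩⟩
    · rw [hp.closure_image_of_disjoint (hdis i)]
      exact (hpc _).image hp.isQuotientMap.continuous
    · exact (hoc i.succ).imp (hp.isOpen_image · (hsat i)) (hp.isClosed_image · (hsat i))
    · intro i j hij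
      rw [hp.closure_image_of_disjoint (hdis i), hp.closure_image_of_disjoint (hdis j)]
      refine disjoint_left.2 ?_
      rintro _ hi ⟨y, hy, rfl⟩
      have hyi : y ∈ closure (A i.succ) := by
        rw [← hp.preimage_image_of_disjoint (hdis i)]
        exact hi
      exact disjoint_left.1 (hd _ _ fun h => hij (Fin.succ_injective n h)) hyi hy

end IsCollapse

theorem isCollapse_quot_mk (A : Set X) :
    IsCollapse (Quot.mk fun x y => x ∈ A ∧ y ∈ A) A where
  isQuotientMap := isQuotientMap_quot_mk
  eq_iff x y := by
    refine ⟨fun h => ?_, ?_⟩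
    · replace h := Quot.eqvGen_exact h
      induction h with
      | rel _ _ h => exact .inr h
      | refl => exact .inl rfl
      | symm _ _ _ ih => exact ih.imp Eq.symm And.symm
      | trans _ _ _ _ _ ih₁ ih₂ =>
        rcases ih₁ with rfl | h
        · exact ih₂
        · rcases ih₂ with rfl | h'
          exacts [.inr h, .inr ⟨h.1, h'.2⟩]
    · rintro (rfl | h)
      exacts [rfl, Quot.sound h]

theorem CollapseCondition.hasDenseLoops {Z : Type*} [TopologicalSpace Z] {n : ℕ} :
    ∀ {X : Type u} [TopologicalSpace X] {A : Fin n → Set X}, CollapseCondition A →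
    ∀ f : C(X, Z), IsQuotientMap f →
    (∀ x y, f x = f y ↔ Relation.EqvGen (collapseRelFam A) x y) → HasDenseLoops f := by
  induction n with
  | zero =>
    intro X _ A _ f hf hfA x U _ _ ⟨β, hβ⟩
    have hinj : ∀ x y, f x = f y → x = y := fun x y h => by
      replace h := (hfA x y).1 h
      induction h with
      | rel _ _ h => exact h.choose.elim0
      | refl => rfl
      | symm _ _ _ ih => exact ih.symm
      | trans _ _ _ _ _ ih₁ ih₂ => exact ih₁.trans ih₂
    have hcol : IsCollapse f (∅ : Set X) :=
      ⟨hf, fun x y => ⟨fun h => .inl (hinj x y h), by simp +contextual⟩⟩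
    obtain ⟨g, hg⟩ := hf.surjective.hasRightInverse
    have hgc : Continuous g := by
      simpa using hcol.continuousOn_section (.inl isOpen_empty) hg
    have hgx : g (f x) = x := hinj _ _ (hg _)
    refine ⟨(β.map hgc).cast hgx.symm hgx.symm, ?_⟩
    convert hβ
    ext t
    exact hg _
  | succ n ih =>
    intro X _ A hA f hf hfA
    have hp := isCollapse_quot_mk (A 0)
    set r : X → X → Prop := fun x y => x ∈ A 0 ∧ y ∈ A 0
    let p : C(X, Quot r) := ⟨Quot.mk r, continuous_quot_mk⟩
    have hlift : ∀ x y, r x y → f x = f y := fun x y h => (hfA x y).2 (.rel _ _ ⟨0, h⟩)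
    let g : C(Quot r, Z) := ⟨Quot.lift f hlift, continuous_quot_lift hlift f.continuous⟩
    have hgp : g.comp p = f := rfl
    have hg : IsQuotientMap g := .of_comp p.continuous g.continuous hf
    rw [← hgp]
    refine (ih (hp.collapseCondition_image hA) g hg ?_).comp
      (IsCollapse.hasDenseLoops (p := p) hp ?_ (hA.1 0))
    · rintro ⟨x⟩ ⟨y⟩
      refine (hfA x y).trans ⟨fun h => ?_, fun h => ?_⟩
      · induction h with
        | rel x y h =>
          obtain ⟨i, hx, hy⟩ := h
          induction i using Fin.cases with
          | zero => exact (hp.eq_of_mem hx hy : Quot.mk r x = Quot.mk r y) ▸ .refl _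
          | succ i => exact .rel _ _ ⟨i, mem_image_of_mem _ hx, mem_image_of_mem _ hy⟩
        | refl => exact .refl _
        | symm _ _ _ ih => exact .symm _ _ ih
        | trans _ _ _ _ _ ih₁ ih₂ => exact .trans _ _ _ ih₁ ih₂
      · refine (hfA x y).1 (?_ : g (Quot.mk r x) = g (Quot.mk r y))
        generalize Quot.mk r x = u, Quot.mk r y = v at h ⊢
        induction h with
        | rel u v h =>
          obtain ⟨i, ⟨u', hu, rfl⟩, ⟨v', hv, rfl⟩⟩ := h
          exact (hfA u' v').2 (.rel _ _ ⟨i.succ, hu, hv⟩)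
        | refl => rfl
        | symm _ _ _ ih => exact ih.symm
        | trans _ _ _ _ _ ih₁ ih₂ => exact ih₁.trans ih₂
    · obtain ⟨-, h | ⟨hX, hoc, -⟩⟩ := hA
      · exact .inl (h 0)
      · exact (hoc 0).imp_right fun h => ⟨h, hX⟩

end Family

theorem HasDenseLoops.eq_empty_or_univ [SimplyConnectedSpace X] {p : C(X, Y)}
    (hp : HasDenseLoops p) (x : X) {U : Set (Path.Homotopic.Quotient (p x) (p x))}
    (hU : IsOpen U) : U = ∅ ∨ U = univ := by
  have hmk : Continuous (Path.Homotopic.Quotient.mk (x₀ := p x) (x₁ := p x)) :=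
    continuous_quot_mk
  refine U.eq_empty_or_nonempty.imp_right fun ⟨g, hg⟩ => eq_univ_of_forall fun h => ?_
  induction g using Path.Homotopic.Quotient.ind with | mk g => ?_
  induction h using Path.Homotopic.Quotient.ind with | mk h => ?_
  obtain ⟨γ, hγ⟩ := hp x {β | Path.Homotopic.Quotient.mk (h.trans β) ∈ U}
    (hU.preimage (hmk.comp (continuous_const.path_trans continuous_id)))
    (fun β β' hβ => by
      rw [mem_ofPred_eq, mem_ofPred_eq,
        Path.Homotopic.Quotient.eq.2 ((Path.Homotopic.refl h).hcomp hβ)]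
      exact id)
    ⟨h.symm.trans g, by
      have : (h.trans (h.symm.trans g)).Homotopic g :=
        ⟨(Path.Homotopy.transAssoc h h.symm g).symm.trans
          (((Path.Homotopy.reflTransSymm h).symm.hcomp (.refl g)).trans
            (Path.Homotopy.reflTrans g))⟩
      rw [mem_ofPred_eq, Path.Homotopic.Quotient.eq.2 this]
      exact hg⟩
  have hnull : (γ.map p.continuous).Homotopic (Path.refl (p x)) :=
    (SimplyConnectedSpace.paths_homotopic γ (Path.refl x)).map p
  have : (h.trans (γ.map p.continuous)).Homotopic h :=
    ((Path.Homotopic.refl h).hcomp hnull).trans ⟨Path.Homotopy.transRefl h⟩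
  rwa [mem_ofPred_eq, Path.Homotopic.Quotient.eq.2 this] at hγ

end TopologicalFundamentalGroup

/-- If `(X, A₁, …, Aₙ)` satisfies condition (*) and `X` is simply connected, then
`π₁ᵗᵒᵖ(X/(A₁,…,Aₙ),*)` is an indiscrete topological group: its only open subsets are `∅` and
the whole group. -/
theorem pi1_top_quotient_indiscrete_of_simplyConnected
    {X : Type*} [TopologicalSpace X] [SimplyConnectedSpace X]
    {n : ℕ} (A : Fin n → Set X) (hstar : StarCondition A)
    (a : X) (ha : a ∈ ⋃ i, A i)
    (U : Set (Path.Homotopic.Quotient (Quot.mk (collapseRelFam A) a)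
      (Quot.mk (collapseRelFam A) a)))
    (hU : IsOpen U) : U = ∅ ∨ U = Set.univ := by
  have hdense := hstar.collapseCondition.hasDenseLoops
    ⟨Quot.mk (collapseRelFam A), continuous_quot_mk⟩ isQuotientMap_quot_mk
    fun x y => ⟨Quot.eqvGen_exact, Quot.eqvGen_sound⟩
  exact hdense.eq_empty_or_univ a hU
end

section
/- Let (X,A₁,...,Aₙ) satisfy condition (*) with a ∈ ⋃ᵢ₌₁ⁿ Aᵢ. If π₁^top(X,a) is compact and π₁^top(X/(A₁,...,Aₙ),*) is Hausdorff, then either π₁^top(X/(A₁,...,Aₙ),*) carries the discrete topology, or π₁(X/(A₁,...,Aₙ),*) is uncountable. -/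
open Set Topology unitInterval

namespace Path

section Indiscrete

variable {Y : Type*} [TopologicalSpace Y]

/-- Two paths with the same endpoints inside the closure of a single point are homotopic. -/
theorem homotopic_of_mem_closure_singleton_s16 {o y z : Y} (γ γ' : Path y z)
    (h : ∀ t, γ t ∈ closure {o}) (h' : ∀ t, γ' t ∈ closure {o}) : γ.Homotopic γ' := by
  classical
  set H : I × I → Y := fun q => if q.1 = 0 then γ q.2 else if q.1 = 1 then γ' q.2 else
    if q.2 = 0 then y else if q.2 = 1 then z else o with hH
  have hy : y ∈ closure {o} := by simpa using h 0
  have hz : z ∈ closure {o} := by simpa using h 1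
  have hmem : ∀ q, H q ∈ closure {o} := by
    intro q
    simp only [hH]
    split_ifs
    exacts [h _, h' _, hy, hz, subset_closure rfl]
  have hcont : Continuous H := by
    refine continuous_def.2 fun V hV => ?_
    by_cases ho : o ∈ V
    · rw [← isClosed_compl_iff]
      have : (H ⁻¹' V)ᶜ = (({0} ×ˢ (γ ⁻¹' Vᶜ) ∪ {1} ×ˢ (γ' ⁻¹' Vᶜ)) ∪
          univ ×ˢ ({0} ∩ γ ⁻¹' Vᶜ)) ∪ univ ×ˢ ({1} ∩ γ ⁻¹' Vᶜ) := by
        ext ⟨s, t⟩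
        simp only [hH, mem_compl_iff, mem_preimage, mem_union, mem_prod, mem_singleton_iff,
          mem_inter_iff, mem_univ, true_and]
        by_cases hs : s = 0 <;> by_cases hs' : s = 1 <;> by_cases ht : t = 0 <;>
          by_cases ht' : t = 1 <;> simp_all
      rw [this]
      have h1 : IsClosed (γ ⁻¹' Vᶜ) := hV.isClosed_compl.preimage γ.continuous
      have h2 : IsClosed (γ' ⁻¹' Vᶜ) := hV.isClosed_compl.preimage γ'.continuous
      exact (((isClosed_singleton.prod h1).union (isClosed_singleton.prod h2)).union
        (isClosed_univ.prod (isClosed_singleton.inter h1))).union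
        (isClosed_univ.prod (isClosed_singleton.inter h1))
    · convert! isOpen_empty
      refine eq_empty_of_forall_notMem fun q hq => ho ?_
      obtain ⟨w, hw, rfl⟩ := mem_closure_iff.1 (hmem q) V hV hq
      exact hw
  refine ⟨⟨⟨⟨H, hcont⟩, fun t => by simp [hH], fun t => by simp [hH]⟩, ?_⟩⟩
  rintro t x (rfl | rfl)
  · simp [hH]
  · simp [hH]

/-- A path from a point of the closure of `{o}` to `o` that takes no further values. -/
theorem exists_path_of_mem_closure_singleton {o y : Y} (hy : y ∈ closure {o}) :
    ∃ γ : Path y o, ∀ t, γ t = y ∨ γ t = o := by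
  classical
  refine ⟨⟨⟨fun t => if t = 0 then y else o, continuous_def.2 fun V hV => ?_⟩, by simp, by simp⟩,
    fun t => ?_⟩
  · by_cases hyV : y ∈ V
    · obtain ⟨w, hw, rfl⟩ := mem_closure_iff.1 hy V hV hyV
      convert! isOpen_univ
      ext t
      by_cases ht : t = 0 <;> simp [ht, hyV, hw]
    · by_cases ho : o ∈ V
      · convert! (isClosed_singleton (x := (0 : I))).isOpen_compl
        ext t
        by_cases ht : t = 0 <;> simp [ht, hyV, ho]
      · convert! isOpen_empty
        ext t
        by_cases ht : t = 0 <;> simp [ht, hyV, ho]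
  · by_cases ht : t = 0 <;> simp [ht]

end Indiscrete

section Liftable

variable {X Y : Type*} [TopologicalSpace X] [TopologicalSpace Y] (p : C(X, Y))

/-- A path in `Y` is liftable along `p` up to homotopy if it is homotopic, relative to its
endpoints, to the image under `p` of a path in `X`. -/
def HomotopyLiftable {y y' : Y} (γ : Path y y') : Prop :=
  ∃ (x x' : X) (β : Path x x') (hx : y = p x) (hx' : y' = p x'),
    γ.Homotopic ((β.map p.continuous).cast hx hx')

/-- Two points are null-joined along `p` if they are joined by a path whose image under `p` is a
null-homotopic loop. -/
def NullJoined (x x' : X) : Prop :=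
  ∃ (β : Path x x') (h : p x = p x'), ((β.map p.continuous).cast rfl h).Homotopic (Path.refl (p x))

/-- Two points of `Y` are joined inside `V` by a path liftable up to homotopy. -/
def LiftJoinedIn (V : Set Y) (y y' : Y) : Prop :=
  ∃ γ : Path y y', HomotopyLiftable p γ ∧ ∀ t, γ t ∈ V

variable {p}

theorem NullJoined.refl (x : X) : NullJoined p x x :=
  ⟨Path.refl x, rfl, Homotopic.refl _⟩

theorem NullJoined.symm {x x' : X} (h : NullJoined p x x') : NullJoined p x' x := by
  obtain ⟨β, h, hβ⟩ := h
  refine ⟨β.symm, h.symm, ?_⟩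
  have := hβ.symm₂.pathCast h.symm h.symm
  convert! this using 1
  ext t
  simp [h]

theorem NullJoined.trans {x x' x'' : X} (h : NullJoined p x x') (h' : NullJoined p x' x'') :
    NullJoined p x x'' := by
  obtain ⟨β, h, hβ⟩ := h
  obtain ⟨β', h', hβ'⟩ := h'
  refine ⟨β.trans β', h.trans h', ?_⟩
  have e₁ : ((β.trans β').map p.continuous).cast rfl (h.trans h') =
      ((β.map p.continuous).cast rfl h).trans (((β'.map p.continuous).cast rfl h').cast h h) := by
    ext t
    simp only [Path.cast_coe, Path.map_coe, Function.comp_apply, Path.trans_apply]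
    split_ifs <;> rfl
  have e₂ : (Path.refl (p x)).trans ((Path.refl (p x')).cast h h) = Path.refl (p x) := by
    ext t
    simp [Path.trans_apply, h]
  rw [e₁, ← e₂]
  exact hβ.hcomp (hβ'.pathCast h h)

theorem HomotopyLiftable.symm {y y' : Y} {γ : Path y y'} (h : HomotopyLiftable p γ) :
    HomotopyLiftable p γ.symm := by
  obtain ⟨x, x', β, rfl, rfl, hβ⟩ := h
  exact ⟨x', x, β.symm, rfl, rfl, hβ.symm₂⟩

theorem HomotopyLiftable.trans (hF : ∀ x x', p x = p x' → NullJoined p x x') {y y' y'' : Y}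
    {γ : Path y y'} {γ' : Path y' y''} (h : HomotopyLiftable p γ) (h' : HomotopyLiftable p γ') :
    HomotopyLiftable p (γ.trans γ') := by
  obtain ⟨x, x', β, rfl, rfl, hβ⟩ := h
  obtain ⟨x₁, x₁', β', hx, rfl, hβ'⟩ := h'
  obtain ⟨δ, hx, hδ⟩ := hF _ _ hx
  refine ⟨x, x₁', β.trans (δ.trans β'), rfl, rfl, ?_⟩
  have key : γ'.Homotopic (((δ.map p.continuous).cast rfl hx).trans
      ((β'.map p.continuous).cast hx rfl)) :=
    (hβ'.trans (Homotopic.symm ⟨Homotopy.reflTrans _⟩)).trans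
      (hδ.symm.hcomp (Homotopic.refl _))
  refine (hβ.hcomp key).trans ?_
  convert! Homotopic.refl _ using 1
  ext t
  simp only [Path.cast_coe, Path.map_coe, Function.comp_apply, Path.trans_apply]
  split_ifs <;> rfl

theorem LiftJoinedIn.symm {V : Set Y} {y y' : Y} (h : LiftJoinedIn p V y y') :
    LiftJoinedIn p V y' y := by
  obtain ⟨γ, hγ, hV⟩ := h
  exact ⟨γ.symm, hγ.symm, fun t => hV _⟩

theorem LiftJoinedIn.trans (hF : ∀ x x', p x = p x' → NullJoined p x x') {V : Set Y}
    {y y' y'' : Y} (h : LiftJoinedIn p V y y') (h' : LiftJoinedIn p V y' y'') :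
    LiftJoinedIn p V y y'' := by
  obtain ⟨γ, hγ, hV⟩ := h
  obtain ⟨γ', hγ', hV'⟩ := h'
  refine ⟨γ.trans γ', hγ.trans hF hγ', fun t => ?_⟩
  rw [Path.trans_apply]
  split_ifs
  exacts [hV _, hV' _]

theorem LiftJoinedIn.of_path {V : Set Y} {x x' : X} (β : Path x x') (h : ∀ t, p (β t) ∈ V) :
    LiftJoinedIn p V (p x) (p x') :=
  ⟨β.map p.continuous, ⟨x, x', β, rfl, rfl, Homotopic.refl _⟩, h⟩

theorem LiftJoinedIn.refl (hp : Function.Surjective p) {V : Set Y} {y : Y} (hy : y ∈ V) :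
    LiftJoinedIn p V y y := by
  obtain ⟨x, rfl⟩ := hp y
  exact .of_path (Path.refl x) fun _ => hy

/-- An image path inside the closure of `{o}` ending at `o` may be replaced by one inside any
set that contains its source and `o`. -/
theorem LiftJoinedIn.of_mem_closure_singleton {V : Set Y} {x x' : X} (β : Path x x')
    (h : ∀ t, p (β t) ∈ closure {p x'}) (hx : p x ∈ V) (hx' : p x' ∈ V) :
    LiftJoinedIn p V (p x) (p x') := by
  have hxc : p x ∈ closure {p x'} := by simpa using h 0
  obtain ⟨γ, hγ⟩ := exists_path_of_mem_closure_singleton hxc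
  refine ⟨γ, ⟨x, x', β, rfl, rfl, homotopic_of_mem_closure_singleton_s16 γ _ (o := p x') ?_ h⟩, ?_⟩
  · intro t
    rcases hγ t with h | h <;> rw [h]
    exacts [hxc, subset_closure rfl]
  · intro t
    rcases hγ t with h | h <;> rw [h] <;> assumption

/-- Bisection: if a path is locally replaceable by liftable paths within arbitrary open sets, it
can be replaced by a liftable path subject to locally uniform open constraints `c`. -/
theorem exists_homotopyLiftable_forall_mem (hF : ∀ x x', p x = p x' → NullJoined p x x')
    (hL : ∀ (f : C(ℝ, Y)) (V : Set Y), IsOpen V → (∀ u, f u ∈ V) → ∀ a b,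
      LiftJoinedIn p V (f a) (f b))
    (f : C(ℝ, Y)) (c : ℝ → Set Y) (n : ℕ) : ∀ a b : ℝ, a ≤ b →
    (∀ s t, a ≤ s → s ≤ t → t ≤ b → t - s ≤ (b - a) / 2 ^ n →
      ∃ V, IsOpen V ∧ ∀ u ∈ Icc s t, f u ∈ V ∧ V ⊆ c u) →
    ∃ γ : Path (f a) (f b), HomotopyLiftable p γ ∧ ∀ u : I, γ u ∈ c (a + (b - a) * u) := by
  induction n with
  | zero =>
    intro a b hab h
    obtain ⟨V, hV, hVc⟩ := h a b le_rfl hab le_rfl (by simp)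
    have hab' : LiftJoinedIn p V (f (projIcc a b hab a)) (f (projIcc a b hab b)) :=
      hL (f.comp ⟨fun u => projIcc a b hab u, by fun_prop⟩) V hV
        (fun u => (hVc _ (projIcc a b hab u).2).1) a b
    rw [projIcc_left, projIcc_right] at hab'
    obtain ⟨γ, hγ, hγV⟩ := hab'
    refine ⟨γ, hγ, fun u => (hVc _ ⟨?_, ?_⟩).2 (hγV u)⟩
    · nlinarith [u.2.1]
    · nlinarith [u.2.2]
  | succ n ih =>
    intro a b hab h
    set m := (a + b) / 2 with hm
    have hpow : (b - a) / 2 ^ (n + 1) = (b - a) / 2 / 2 ^ n := by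
      rw [pow_succ]; field_simp
    obtain ⟨γ₁, hγ₁, hc₁⟩ := ih a m (by linarith) fun s t h1 h2 h3 h4 =>
      h s t h1 h2 (by linarith) (h4.trans_eq (by rw [hpow]; congr 1; linarith))
    obtain ⟨γ₂, hγ₂, hc₂⟩ := ih m b (by linarith) fun s t h1 h2 h3 h4 =>
      h s t (by linarith) h2 h3 (h4.trans_eq (by rw [hpow]; congr 1; linarith))
    refine ⟨γ₁.trans γ₂, hγ₁.trans hF hγ₂, fun u => ?_⟩
    rw [Path.trans_apply]
    split_ifs
    · convert! hc₁ _ using 2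
      simp only [hm]; ring
    · convert! hc₂ _ using 2
      simp only [hm]; ring

/-- Liftable paths are dense in the path space. -/
theorem dense_homotopyLiftable (hF : ∀ x x', p x = p x' → NullJoined p x x')
    (hL : ∀ (f : C(ℝ, Y)) (V : Set Y), IsOpen V → (∀ u, f u ∈ V) → ∀ a b,
      LiftJoinedIn p V (f a) (f b)) (y y' : Y) :
    Dense {γ : Path y y' | HomotopyLiftable p γ} := by
  intro α
  rw [mem_closure_iff_nhds]
  intro N hN
  rw [nhds_induced, Filter.mem_comap] at hN
  obtain ⟨M, hM, hMN⟩ := hN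
  obtain ⟨S, hfin, hS, hSM⟩ := ContinuousMap.mem_nhds_iff.1 hM
  set e : ℝ → I := projIcc 0 1 zero_le_one with he
  have he_cont : Continuous e := continuous_projIcc
  set c : ℝ → Set Y := fun t => ⋂ q ∈ {q ∈ S | e t ∈ q.1}, q.2 with hc
  have hc_open : ∀ t, IsOpen (c t) := fun t =>
    (hfin.subset (sep_subset _ _)).isOpen_biInter fun q hq => (hS q.1 q.2 hq.1).2.1
  have hαc : ∀ t, α (e t) ∈ c t := fun t =>
    mem_iInter₂.2 fun q hq => (hS q.1 q.2 hq.1).2.2 hq.2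
  set J : ℝ → Set ℝ := fun t => (fun u => α (e u)) ⁻¹' c t ∩
    ⋂ q ∈ {q ∈ S | e t ∉ q.1}, e ⁻¹' q.1ᶜ with hJ
  have hJ_open : ∀ t, IsOpen (J t) := fun t =>
    ((hc_open t).preimage (α.continuous.comp he_cont)).inter <|
      (hfin.subset (sep_subset _ _)).isOpen_biInter fun q hq =>
        (hS q.1 q.2 hq.1).1.isClosed.isOpen_compl.preimage he_cont
  have hJ_mem : ∀ t, t ∈ J t := fun t => ⟨hαc t, mem_iInter₂.2 fun q hq => hq.2⟩
  have hJc : ∀ t, ∀ u ∈ J t, c t ⊆ c u := by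
    intro t u hu y hy
    refine mem_iInter₂.2 fun q hq => mem_iInter₂.1 hy q ⟨hq.1, ?_⟩
    by_contra hqt
    exact mem_iInter₂.1 hu.2 q ⟨hq.1, hqt⟩ hq.2
  obtain ⟨δ, hδ, hball⟩ := lebesgue_number_lemma_of_metric (isCompact_Icc (a := (0 : ℝ)) (b := 1))
    hJ_open (fun t _ => mem_iUnion.2 ⟨t, hJ_mem t⟩)
  obtain ⟨n, hn⟩ := exists_pow_lt_of_lt_one hδ (by norm_num : (1 / 2 : ℝ) < 1)
  obtain ⟨γ, hγ, hγc⟩ := exists_homotopyLiftable_forall_mem hF hL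
    ⟨fun u => α (e u), α.continuous.comp he_cont⟩ c n 0 1 zero_le_one (by
      intro s t hs hst ht hlen
      obtain ⟨i, hi⟩ := hball s ⟨hs, hst.trans ht⟩
      refine ⟨c i, hc_open i, fun u hu => ?_⟩
      have : u ∈ J i := by
        refine hi ?_
        rw [Metric.mem_ball, Real.dist_eq, abs_of_nonneg (by linarith [hu.1])]
        have : (1 - 0 : ℝ) / 2 ^ n = (1 / 2) ^ n := by simp
        linarith [hu.2]
      exact ⟨this.1, hJc i u this⟩)
  have h0 : y = α (e 0) := by simp [he]
  have h1 : y' = α (e 1) := by simp [he]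
  refine ⟨γ.cast h0 h1, hMN (hSM ?_), ?_⟩
  · intro K U hKU u hu
    have := mem_iInter₂.1 (hγc u) (K, U) ⟨hKU, by simpa [he] using hu⟩
    exact this
  · obtain ⟨x, x', β, hx, hx', h⟩ := hγ
    exact ⟨x, x', β, h0.trans hx, h1.trans hx', h.pathCast h0 h1⟩

end Liftable

end Path
section FundamentalGroup

variable {X Y : Type*} [TopologicalSpace X] [TopologicalSpace Y]

namespace Path.Homotopic.Quotient

theorem continuous_mk (x x' : X) : Continuous (mk : Path x x' → Path.Homotopic.Quotient x x') :=
  continuous_coinduced_rng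

theorem continuous_map (p : C(X, Y)) (x x' : X) :
    Continuous fun q : Path.Homotopic.Quotient x x' => q.map p := by
  refine continuous_coinduced_dom.2 ?_
  refine (continuous_mk (p x) (p x')).comp (f := fun γ : Path x x' => γ.map p.continuous) ?_
  exact continuous_induced_rng.2 ((ContinuousMap.continuous_postcomp p).comp continuous_induced_dom)

theorem continuous_trans_right {x x' x'' : X} (r : Path.Homotopic.Quotient x' x'') :
    Continuous fun q : Path.Homotopic.Quotient x x' => q.trans r := by
  induction r with | mk γ =>
  refine continuous_coinduced_dom.2 ?_
  refine (continuous_mk x x'').comp (f := fun β : Path x x' => β.trans γ) ?_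
  exact Path.continuous_trans.comp (Continuous.prodMk_left γ)

/-- A countable compact Hausdorff topological fundamental group is discrete. -/
theorem discreteTopology_of_countable (x : X) [CompactSpace (Path.Homotopic.Quotient x x)]
    [T2Space (Path.Homotopic.Quotient x x)] [Countable (Path.Homotopic.Quotient x x)] :
    DiscreteTopology (Path.Homotopic.Quotient x x) := by
  have : Nonempty (Path.Homotopic.Quotient x x) := ⟨refl x⟩
  obtain ⟨g, hg⟩ := nonempty_interior_of_iUnion_of_closed
    (f := fun g : Path.Homotopic.Quotient x x => ({g} : Set _)) (fun g => isClosed_singleton)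
    (iUnion_of_singleton _)
  have hgo : IsOpen ({g} : Set (Path.Homotopic.Quotient x x)) := by
    obtain ⟨w, hw⟩ := hg
    obtain rfl : w = g := mem_singleton_iff.1 (interior_subset hw)
    exact isOpen_singleton_iff_nhds_eq_pure _ |>.2
      (le_antisymm (Filter.le_pure_iff.2 (mem_interior_iff_mem_nhds.1 hw)) (pure_le_nhds _))
  refine discreteTopology_iff_isOpen_singleton.2 fun h => ?_
  induction g with | mk α =>
  induction h with | mk β =>
  convert! hgo.preimage (continuous_trans_right (x := x) (mk (β.symm.trans α)))
  ext q
  induction q with | mk γ =>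
  have hassoc : (mk γ).trans (mk (β.symm.trans α)) = mk ((γ.trans β.symm).trans α) :=
    (Quotient.eq.2 ⟨Homotopy.transAssoc γ β.symm α⟩).symm
  simp only [mem_singleton_iff, mem_preimage, hassoc]
  rw [Quotient.eq, Quotient.eq]
  constructor
  · intro h
    exact ((h.hcomp (Homotopic.refl β.symm)).hcomp (Homotopic.refl α)).trans
      ((Homotopic.hcomp (Homotopic.symm ⟨Homotopy.reflTransSymm β⟩) (Homotopic.refl α)).trans
        ⟨Homotopy.reflTrans α⟩)
  · intro h
    have h₁ : (((γ.trans β.symm).trans α).trans (α.symm.trans β)).Homotopic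
        (α.trans (α.symm.trans β)) := h.hcomp (Homotopic.refl _)
    have cancel : ∀ δ ε : Path x x, (δ.trans (δ.symm.trans ε)).Homotopic ε := fun δ ε =>
      (Homotopic.symm ⟨Homotopy.transAssoc δ δ.symm ε⟩).trans
        ((Homotopic.hcomp (Homotopic.symm ⟨Homotopy.reflTransSymm δ⟩) (Homotopic.refl ε)).trans
          ⟨Homotopy.reflTrans ε⟩)
    have cancel' : (α.trans (α.symm.trans β)).Homotopic β := cancel α β
    have h₂ : (((γ.trans β.symm).trans α).trans (α.symm.trans β)).Homotopic γ := by
      refine Homotopic.trans ⟨Homotopy.transAssoc _ _ _⟩ ?_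
      refine ((Homotopic.refl _).hcomp cancel').trans ?_
      refine Homotopic.trans ⟨Homotopy.transAssoc _ _ _⟩ ?_
      exact ((Homotopic.refl γ).hcomp (Homotopic.symm ⟨Homotopy.reflSymmTrans β⟩)).trans
        ⟨Homotopy.transRefl γ⟩
    exact (Homotopic.symm h₂).trans (h₁.trans cancel')

theorem denseRange_map {p : C(X, Y)} (hF : ∀ x x', p x = p x' → NullJoined p x x')
    (hL : ∀ (f : C(ℝ, Y)) (V : Set Y), IsOpen V → (∀ u, f u ∈ V) → ∀ a b,
      LiftJoinedIn p V (f a) (f b)) (x x' : X) :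
    DenseRange fun q : Path.Homotopic.Quotient x x' => q.map p := by
  refine ((mk_surjective (x₀ := p x) (x₁ := p x')).denseRange.dense_image (continuous_mk _ _)
    (dense_homotopyLiftable hF hL _ _)).mono ?_
  rintro _ ⟨γ, ⟨z, z', β, hz, hz', hβ⟩, rfl⟩
  obtain ⟨δ, h, hδ⟩ := hF _ _ hz
  obtain ⟨δ', h', hδ'⟩ := hF _ _ hz'.symm
  refine ⟨mk (δ.trans (β.trans δ')), ?_⟩
  change (mk (δ.trans (β.trans δ'))).map p = mk γ
  rw [← mk_map, Quotient.eq]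
  have e : (δ.trans (β.trans δ')).map p.continuous = ((δ.map p.continuous).cast rfl h).trans
      (((β.map p.continuous).cast hz hz').trans
        (((δ'.map p.continuous).cast rfl h').cast hz' hz')) := by
    ext t
    simp only [Path.cast_coe, Path.map_coe, Function.comp_apply, Path.trans_apply]
    split_ifs <;> rfl
  rw [e]
  refine (hδ.hcomp (hβ.symm.hcomp (hδ'.pathCast hz' hz'))).trans ?_
  refine Homotopic.trans ⟨Homotopy.reflTrans _⟩ ?_
  have e' : (Path.refl (p z')).cast hz' hz' = Path.refl (p x') := by
    ext t
    simp [hz']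
  rw [e']
  exact ⟨Homotopy.transRefl γ⟩

end Path.Homotopic.Quotient

end FundamentalGroup

section Collapse

open Path

variable {X : Type*} [TopologicalSpace X] {n : ℕ} (A : Fin n → Set X)

/-- The quotient map collapsing each member of `A` to a point. -/
def collapseMap : C(X, Quot (collapseRelFam A)) :=
  ⟨Quot.mk _, continuous_quot_mk⟩

variable {A}

theorem isQuotientMap_collapseMap : IsQuotientMap (collapseMap A) :=
  isQuotientMap_quot_mk

theorem collapseMap_eq_of_mem {i : Fin n} {x x' : X} (h : x ∈ A i) (h' : x' ∈ A i) :
    collapseMap A x = collapseMap A x' :=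
  Quot.sound ⟨i, h, h'⟩

theorem eq_or_mem_of_collapseMap_eq {x x' : X} (h : collapseMap A x = collapseMap A x') :
    x = x' ∨ (∃ i, x ∈ A i) ∧ ∃ i, x' ∈ A i := by
  replace h := Quot.eqvGen_exact h
  induction h with
  | rel x y h => obtain ⟨i, hx, hy⟩ := h; exact .inr ⟨⟨i, hx⟩, ⟨i, hy⟩⟩
  | refl => exact .inl rfl
  | symm x y _ ih => grind
  | trans x y z _ _ ih ih' => grind

theorem collapseMap_mem_closure {i : Fin n} {x z : X} (hx : x ∈ A i) (hz : z ∈ closure (A i)) :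
    collapseMap A z ∈ closure {collapseMap A x} := by
  refine closure_mono ?_ (image_closure_subset_closure_image (collapseMap A).continuous
    (mem_image_of_mem _ hz))
  rintro _ ⟨w, hw, rfl⟩
  exact collapseMap_eq_of_mem hw hx

theorem nullJoined_collapseMap (hA : ∀ i, IsPathConnected (closure (A i))) {x x' : X}
    (h : collapseMap A x = collapseMap A x') : NullJoined (collapseMap A) x x' := by
  replace h := Quot.eqvGen_exact h
  induction h with
  | rel x y h =>
    obtain ⟨i, hx, hy⟩ := h
    obtain ⟨β, hβ⟩ := (hA i).joinedIn x (subset_closure hx) y (subset_closure hy)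
    exact ⟨β, collapseMap_eq_of_mem hx hy, homotopic_of_mem_closure_singleton_s16 _ _
      (fun t => collapseMap_mem_closure hx (hβ t)) fun t => subset_closure rfl⟩
  | refl x => exact .refl x
  | symm _ _ _ ih => exact ih.symm
  | trans _ _ _ _ _ ih ih' => exact ih.trans ih'

/-- Over a locally path connected space, path-joined points of an open set are joined by liftable
paths in it. -/
theorem liftJoinedIn_of_locallyPathConnectedSpace {Y : Type*} [TopologicalSpace Y]
    [LocallyPathConnectedSpace X] {p : C(X, Y)} (hp : IsQuotientMap p)
    (hF : ∀ x x', p x = p x' → NullJoined p x x') (f : C(ℝ, Y)) {V : Set Y} (hV : IsOpen V)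
    (hfV : ∀ u, f u ∈ V) (a b : ℝ) : LiftJoinedIn p V (f a) (f b) := by
  have : Std.Symm fun s t => LiftJoinedIn p V (f s) (f t) := ⟨fun _ _ h => h.symm⟩
  refine PreconnectedSpace.induction₂ (fun s t => LiftJoinedIn p V (f s) (f t)) (fun t => ?_)
    ⟨fun _ _ _ h h' => h.trans hF h'⟩ a b
  have hopen : IsOpen {y | y ∈ V ∧ LiftJoinedIn p V (f t) y} := by
    rw [← hp.isOpen_preimage, isOpen_iff_mem_nhds]
    rintro x ⟨hx, hxt⟩
    filter_upwards [((hV.preimage p.continuous).pathComponentIn x).mem_nhds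
      (mem_pathComponentIn_self hx)] with x' ⟨β, hβ⟩
    exact ⟨by simpa using hβ 1, hxt.trans hF (.of_path β hβ)⟩
  exact (f.continuous.continuousAt.eventually
    (hopen.mem_nhds ⟨hfV t, .refl hp.surjective (hfV t)⟩)).mono fun u hu => hu.2

theorem isOpenMap_collapseMap (hA : ∀ i, IsOpen (A i)) : IsOpenMap (collapseMap A) := by
  intro U hU
  rw [← isQuotientMap_collapseMap.isOpen_preimage]
  have : collapseMap A ⁻¹' (collapseMap A '' U) =
      U ∪ ⋃ k ∈ {k | (A k ∩ collapseMap A ⁻¹' (collapseMap A '' U)).Nonempty}, A k := by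
    refine Subset.antisymm (fun x hx => ?_) (union_subset (subset_preimage_image _ _) ?_)
    · obtain ⟨u, hu, hux⟩ := id hx
      rcases eq_or_mem_of_collapseMap_eq hux with rfl | ⟨-, k, hk⟩
      · exact .inl hu
      · exact .inr (mem_biUnion (x := k) ⟨x, hk, hx⟩ hk)
    · refine iUnion₂_subset fun k ⟨z, hz, hzU⟩ x hx => ?_
      rwa [mem_preimage, collapseMap_eq_of_mem hx hz]
  rw [this]
  exact hU.union (isOpen_biUnion fun k _ => hA k)

/-- Off the collapsed sets, the collapsing map is a closed embedding. -/
theorem isClosedEmbedding_collapseMap_compl (hA : ∀ i, IsOpen (A i)) :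
    IsClosedEmbedding fun x : {x // ∀ i, x ∉ A i} => collapseMap A x := by
  refine .of_continuous_injective_isClosedMap
    ((collapseMap A).continuous.comp continuous_subtype_val) (fun x x' h => ?_) fun K hK => ?_
  · rcases eq_or_mem_of_collapseMap_eq h with h | ⟨⟨i, hi⟩, -⟩
    · exact Subtype.ext h
    · exact absurd hi (x.2 i)
  · rw [← isQuotientMap_collapseMap.isClosed_preimage]
    have hF : IsClosed {x | ∀ i, x ∉ A i} := by
      simp only [ofPred_forall]
      exact isClosed_iInter fun i => (hA i).isClosed_compl
    convert! hF.isClosedEmbedding_subtypeVal.isClosedMap K hK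
    ext x
    constructor
    · rintro ⟨z, hz, hzx⟩
      rcases eq_or_mem_of_collapseMap_eq hzx with h | ⟨⟨i, hi⟩, -⟩
      · exact ⟨z, hz, h⟩
      · exact absurd hi (z.2 i)
    · rintro ⟨z, hz, rfl⟩
      exact ⟨z, hz, rfl⟩

theorem liftJoinedIn_of_mem_closure (hA : ∀ i, IsOpen (A i))
    (hcl : ∀ i, IsPathConnected (closure (A i))) {i : Fin n} {a : X} (ha : a ∈ A i)
    {V : Set (Quot (collapseRelFam A))} (hV : IsOpen V) {y : Quot (collapseRelFam A)} (hy : y ∈ V)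
    (hyc : y ∈ closure {collapseMap A a}) : LiftJoinedIn (collapseMap A) V y (collapseMap A a) := by
  obtain ⟨x, rfl⟩ := isQuotientMap_collapseMap.surjective y
  have haV : collapseMap A a ∈ V := by
    obtain ⟨w, hw, rfl⟩ := mem_closure_iff.1 hyc V hV hy
    exact hw
  have hx : x ∈ collapseMap A ⁻¹' closure {collapseMap A a} := hyc
  rw [(isOpenMap_collapseMap hA).preimage_closure_eq_closure_preimage
    (collapseMap A).continuous] at hx
  have hsub : collapseMap A ⁻¹' {collapseMap A a} ⊆
      ⋃ k ∈ {k | ∃ z ∈ A k, collapseMap A z = collapseMap A a}, A k := by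
    intro z hz
    rcases eq_or_mem_of_collapseMap_eq hz with rfl | ⟨⟨k, hk⟩, -⟩
    · exact mem_biUnion (x := i) ⟨z, ha, rfl⟩ ha
    · exact mem_biUnion (x := k) ⟨z, hk, hz⟩ hk
  have := closure_mono hsub hx
  rw [(toFinite _).closure_biUnion] at this
  obtain ⟨k, ⟨z, hz, hza⟩, hxk⟩ := mem_iUnion₂.1 this
  obtain ⟨β, hβ⟩ := (hcl k).joinedIn x hxk z (subset_closure hz)
  rw [← hza] at haV ⊢
  exact .of_mem_closure_singleton β (fun t => collapseMap_mem_closure hz (hβ t)) hy haV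

/-- A path avoiding the closures of the collapsed points, except perhaps at its source, lifts. -/
theorem liftJoinedIn_of_forall_notMem_closure (hA : ∀ i, IsOpen (A i))
    (f : C(ℝ, Quot (collapseRelFam A))) {V : Set (Quot (collapseRelFam A))}
    (hfV : ∀ u, f u ∈ V) {s u : ℝ} (hsu : s < u)
    (hf : ∀ v ∈ Ioc s u, ∀ i, ∀ a ∈ A i, f v ∉ closure {collapseMap A a}) :
    LiftJoinedIn (collapseMap A) V (f s) (f u) := by
  have hf' : ∀ v ∈ Icc s u, ∀ i, ∀ a ∈ A i, f v ≠ collapseMap A a := by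
    intro v hv i a ha hva
    rcases hv.1.eq_or_lt with rfl | hsv
    · have hopen : IsOpen (f ⁻¹' (collapseMap A '' A i)) :=
        (isOpenMap_collapseMap hA _ (hA i)).preimage f.continuous
      have hmem : f ⁻¹' (collapseMap A '' A i) ∈ 𝓝[>] s :=
        mem_nhdsWithin_of_mem_nhds (hopen.mem_nhds ⟨a, ha, hva.symm⟩)
      obtain ⟨w, ⟨z, hz, hzw⟩, hw⟩ :=
        Filter.nonempty_of_mem (Filter.inter_mem hmem (Ioo_mem_nhdsGT hsu))
      exact hf w ⟨hw.1, hw.2.le⟩ i z hz (subset_closure hzw.symm)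
    · exact hf v ⟨hsv, hv.2⟩ i a ha (subset_closure hva)
  choose g hg using fun v => isQuotientMap_collapseMap.surjective (f v)
  set h : Icc s u → {x // ∀ i, x ∉ A i} := fun v =>
    ⟨g v, fun i hi => hf' v v.2 i _ hi (hg v).symm⟩ with hh
  have hcont : Continuous h := by
    rw [(isClosedEmbedding_collapseMap_compl hA).isEmbedding.continuous_iff]
    convert! f.continuous.comp continuous_subtype_val using 1
    ext v
    exact hg v
  have hmem : ∀ τ : I, s + τ * (u - s) ∈ Icc s u := fun τ =>
    ⟨by nlinarith [τ.2.1], by nlinarith [τ.2.2]⟩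
  have := LiftJoinedIn.of_path (p := collapseMap A) (V := V) (x := g s) (x' := g u)
    ⟨⟨fun τ => h ⟨s + τ * (u - s), hmem τ⟩, by fun_prop⟩, by simp [hh], by simp [hh]⟩
    (fun τ => by
      change collapseMap A (g _) ∈ V
      rw [hg]
      exact hfV _)
  rwa [hg, hg] at this

theorem eventually_liftJoinedIn_of_le (hA : ∀ i, IsOpen (A i))
    (hcl : ∀ i, IsPathConnected (closure (A i))) (f : C(ℝ, Quot (collapseRelFam A)))
    {V : Set (Quot (collapseRelFam A))} (hV : IsOpen V) (hfV : ∀ u, f u ∈ V) (t : ℝ) :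
    ∀ᶠ u in 𝓝 t, t ≤ u → LiftJoinedIn (collapseMap A) V (f t) (f u) := by
  have hF : ∀ x x', collapseMap A x = collapseMap A x' → NullJoined (collapseMap A) x x' :=
    fun _ _ => nullJoined_collapseMap hcl
  choose a ha using fun i => closure_nonempty_iff.1 (hcl i).nonempty
  set D : Fin n → Set ℝ := fun i => f ⁻¹' closure {collapseMap A (a i)} with hD
  have hDc : ∀ i, IsClosed (D i) := fun i => isClosed_closure.preimage f.continuous
  have hO : IsOpen (⋂ i ∈ {i | t ∉ D i}, (D i)ᶜ) :=
    (toFinite _).isOpen_biInter fun i _ => (hDc i).isOpen_compl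
  obtain ⟨ε, hε, hball⟩ := Metric.isOpen_iff.1 hO t (mem_iInter₂.2 fun i hi => hi)
  filter_upwards [Metric.ball_mem_nhds t hε] with u hu htu
  have havoid : ∀ s, s ≤ u → (∀ v ∈ Ioc s u, v ∉ ⋃ i, D i) →
      LiftJoinedIn (collapseMap A) V (f s) (f u) := by
    intro s hsu hs
    rcases hsu.eq_or_lt with rfl | hsu
    · exact .refl isQuotientMap_collapseMap.surjective (hfV _)
    · refine liftJoinedIn_of_forall_notMem_closure hA f hfV hsu fun v hv i z hz hvz =>
        hs v hv (mem_iUnion.2 ⟨i, ?_⟩)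
      rwa [collapseMap_eq_of_mem hz (ha i)] at hvz
  rcases (Icc t u ∩ ⋃ i, D i).eq_empty_or_nonempty with hE | hE
  · exact havoid t htu fun v hv hvE =>
      (eq_empty_iff_forall_notMem.1 hE v) ⟨Ioc_subset_Icc_self hv, hvE⟩
  · obtain ⟨e, ⟨he, heE⟩, hmax⟩ :=
      (isCompact_Icc.inter_right (isClosed_iUnion_of_finite hDc)).exists_isGreatest hE
    obtain ⟨j, hj⟩ := mem_iUnion.1 heE
    have htj : t ∈ D j := by
      by_contra htj
      refine mem_iInter₂.1 (hball ?_) j htj hj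
      rw [Metric.mem_ball, Real.dist_eq, abs_lt] at hu ⊢
      constructor <;> linarith [he.1, he.2, hu.2]
    refine LiftJoinedIn.trans hF (LiftJoinedIn.trans hF
      (liftJoinedIn_of_mem_closure hA hcl (ha j) hV (hfV t) htj)
      (liftJoinedIn_of_mem_closure hA hcl (ha j) hV (hfV e) hj).symm) (havoid e he.2 ?_)
    intro v hv hvE
    exact absurd (hmax ⟨⟨he.1.trans hv.1.le, hv.2⟩, hvE⟩) (not_le.2 hv.1)

/-- When open sets with path connected closures are collapsed, path-joined points of an open set
are joined by liftable paths in it. -/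
theorem liftJoinedIn_collapseMap_of_isOpen (hA : ∀ i, IsOpen (A i))
    (hcl : ∀ i, IsPathConnected (closure (A i))) (f : C(ℝ, Quot (collapseRelFam A)))
    {V : Set (Quot (collapseRelFam A))} (hV : IsOpen V) (hfV : ∀ u, f u ∈ V) (a b : ℝ) :
    LiftJoinedIn (collapseMap A) V (f a) (f b) := by
  have : Std.Symm fun s t => LiftJoinedIn (collapseMap A) V (f s) (f t) := ⟨fun _ _ h => h.symm⟩
  refine PreconnectedSpace.induction₂ (fun s t => LiftJoinedIn (collapseMap A) V (f s) (f t))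
    (fun t => ?_) ⟨fun _ _ _ h h' => h.trans (fun _ _ => nullJoined_collapseMap hcl) h'⟩ a b
  have hneg := eventually_liftJoinedIn_of_le hA hcl (f.comp ⟨Neg.neg, continuous_neg⟩) hV
    (fun u => hfV (-u)) (-t)
  filter_upwards [eventually_liftJoinedIn_of_le hA hcl f hV hfV t,
    (continuous_neg.tendsto t).eventually hneg] with u hu hu'
  rcases le_total t u with h | h
  · exact hu h
  · simpa using hu' (neg_le_neg h)

end Collapse

/-- If `(X, A₁, …, Aₙ)` satisfies condition (*), `π₁ᵗᵒᵖ(X,a)` is compact and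
`π₁ᵗᵒᵖ(X/(A₁,…,Aₙ),*)` is Hausdorff, then `π₁ᵗᵒᵖ(X/(A₁,…,Aₙ),*)` either carries the
discrete topology or is uncountable. -/
theorem pi1_quotient_discrete_or_uncountable
    {X : Type*} [TopologicalSpace X]
    {n : ℕ} (A : Fin n → Set X) (hstar : StarCondition A)
    (a : X) (ha : a ∈ ⋃ i, A i)
    (hcomp : CompactSpace (Path.Homotopic.Quotient a a))
    (ht2 : T2Space (Path.Homotopic.Quotient (Quot.mk (collapseRelFam A) a)
      (Quot.mk (collapseRelFam A) a))) :
    DiscreteTopology (Path.Homotopic.Quotient (Quot.mk (collapseRelFam A) a)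
        (Quot.mk (collapseRelFam A) a)) ∨
      Uncountable (Path.Homotopic.Quotient (Quot.mk (collapseRelFam A) a)
        (Quot.mk (collapseRelFam A) a)) := by
  have hdense : DenseRange fun q : Path.Homotopic.Quotient a a => q.map (collapseMap A) := by
    rcases hstar with ⟨-, h⟩ | ⟨-, -, hloc, -, hcl, -⟩
    · exact Path.Homotopic.Quotient.denseRange_map
        (fun _ _ => nullJoined_collapseMap fun i => (h i).2)
        (fun f V hV hfV =>
          liftJoinedIn_collapseMap_of_isOpen (fun i => (h i).1) (fun i => (h i).2) f hV hfV) a a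
    · have : LocallyPathConnectedSpace X := hloc
      exact Path.Homotopic.Quotient.denseRange_map (fun _ _ => nullJoined_collapseMap hcl)
        (fun f V hV hfV => liftJoinedIn_of_locallyPathConnectedSpace isQuotientMap_collapseMap
          (fun _ _ => nullJoined_collapseMap hcl) f hV hfV) a a
  have hcont := Path.Homotopic.Quotient.continuous_map (collapseMap A) a a
  have : T2Space (Path.Homotopic.Quotient (collapseMap A a) (collapseMap A a)) := ht2
  have hcompact : CompactSpace (Path.Homotopic.Quotient (collapseMap A a) (collapseMap A a)) := by
    have hrange := isCompact_range hcont
    rw [← isCompact_univ_iff, ← hdense.closure_range, hrange.isClosed.closure_eq]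
    exact hrange
  rw [or_iff_not_imp_right, not_uncountable_iff]
  intro (_ : Countable (Path.Homotopic.Quotient (collapseMap A a) (collapseMap A a)))
  exact Path.Homotopic.Quotient.discreteTopology_of_countable (collapseMap A a)
end
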